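/- For all integers m ≥ 0 and l with 2m ≤ l ≤ n, the R-submodule V_{l,m}^g·B_{l−2m} of B_n^k(R) is a left ideal of B_l; that is, x·y ∈ V_{l,m}^g·B_{l−2m} for every x ∈ B_l and y ∈ V_{l,m}^g·B_{l−2m}. -/

import Mathlib

/-!
Cyclotomic BMW algebra `B_n^k(R)`, presented as the quotient of the free `R`-algebra on
generators `Y, Y⁻¹, Xᵢ, Xᵢ⁻¹ (1 ≤ i ≤ n-1), eᵢ (1 ≤ i ≤ n-1)` by the defining relations.
Generators with out-of-range indices are identified with `1` (resp. `0` for the `eᵢ`),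
so that the quotient is exactly the cyclotomic BMW algebra.
-/

inductive BMWGen : Type
  | Y : BMWGen
  | Yinv : BMWGen
  | X : ℕ → BMWGen
  | Xinv : ℕ → BMWGen
  | E : ℕ → BMWGen

namespace CBMW

/-- The parameters of a cyclotomic BMW algebra: `n`, `k`, units `q, λ, q₀` and
families `qc` (the `qᵢ`, with `qc 0 = q₀`) and `A` (the `Aᵢ`). -/
structure Params (R : Type) [CommRing R] where
  n : ℕ
  k : ℕ
  q : Rˣ
  lam : Rˣ
  q0 : Rˣ
  qc : ℕ → R
  A : ℕ → R

variable {R : Type} [CommRing R]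

abbrev F (R : Type) [CommRing R] := FreeAlgebra R BMWGen

def fY : F R := FreeAlgebra.ι R BMWGen.Y
def fYi : F R := FreeAlgebra.ι R BMWGen.Yinv
def fX (i : ℕ) : F R := FreeAlgebra.ι R (BMWGen.X i)
def fXi (i : ℕ) : F R := FreeAlgebra.ι R (BMWGen.Xinv i)
def fE (i : ℕ) : F R := FreeAlgebra.ι R (BMWGen.E i)

/-- `δ = q - q⁻¹`. -/
def Params.delta (P : Params R) : R := (P.q : R) - ((P.q⁻¹ : Rˣ) : R)

/-- `λ⁻¹` as an element of `R`. -/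
def Params.laminv (P : Params R) : R := ((P.lam⁻¹ : Rˣ) : R)

/-- The defining relations of the cyclotomic BMW algebra. -/
inductive Rel (P : Params R) : F R → F R → Prop
  | X_inv_right {i : ℕ} (h1 : 1 ≤ i) (h2 : i ≤ P.n - 1) : Rel P (fX i * fXi i) 1
  | X_inv_left {i : ℕ} (h1 : 1 ≤ i) (h2 : i ≤ P.n - 1) : Rel P (fXi i * fX i) 1
  | Y_inv_right : Rel P (fY * fYi) 1
  | Y_inv_left : Rel P (fYi * fY) 1
  | X_invalid {i : ℕ} (h : i = 0 ∨ P.n - 1 < i) : Rel P (fX i) 1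
  | Xi_invalid {i : ℕ} (h : i = 0 ∨ P.n - 1 < i) : Rel P (fXi i) 1
  | E_invalid {i : ℕ} (h : i = 0 ∨ P.n - 1 < i) : Rel P (fE i) 0
  | skein {i : ℕ} (h1 : 1 ≤ i) (h2 : i ≤ P.n - 1) :
      Rel P (fX i - fXi i) (P.delta • ((1 : F R) - fE i))
  | XX_far {i j : ℕ} (h1 : 1 ≤ i) (h2 : i ≤ P.n - 1) (h3 : 1 ≤ j) (h4 : j ≤ P.n - 1)
      (h : i + 2 ≤ j ∨ j + 2 ≤ i) : Rel P (fX i * fX j) (fX j * fX i)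
  | braid {i : ℕ} (h1 : 1 ≤ i) (h2 : i + 1 ≤ P.n - 1) :
      Rel P (fX i * fX (i+1) * fX i) (fX (i+1) * fX i * fX (i+1))
  | XE_far {i j : ℕ} (h1 : 1 ≤ i) (h2 : i ≤ P.n - 1) (h3 : 1 ≤ j) (h4 : j ≤ P.n - 1)
      (h : i + 2 ≤ j ∨ j + 2 ≤ i) : Rel P (fX i * fE j) (fE j * fX i)
  | EE_far {i j : ℕ} (h1 : 1 ≤ i) (h2 : i ≤ P.n - 1) (h3 : 1 ≤ j) (h4 : j ≤ P.n - 1)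
      (h : i + 2 ≤ j ∨ j + 2 ≤ i) : Rel P (fE i * fE j) (fE j * fE i)
  | untwist_right {i : ℕ} (h1 : 1 ≤ i) (h2 : i ≤ P.n - 1) :
      Rel P (fX i * fE i) ((P.lam : R) • fE i)
  | untwist_left {i : ℕ} (h1 : 1 ≤ i) (h2 : i ≤ P.n - 1) :
      Rel P (fE i * fX i) ((P.lam : R) • fE i)
  | XXE {i j : ℕ} (h1 : 1 ≤ i) (h2 : i ≤ P.n - 1) (h3 : 1 ≤ j) (h4 : j ≤ P.n - 1)
      (h : j = i + 1 ∨ i = j + 1) : Rel P (fX i * fX j * fE i) (fE j * fE i)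
  | EXX {i j : ℕ} (h1 : 1 ≤ i) (h2 : i ≤ P.n - 1) (h3 : 1 ≤ j) (h4 : j ≤ P.n - 1)
      (h : j = i + 1 ∨ i = j + 1) : Rel P (fE j * fE i) (fE j * fX i * fX j)
  | EEE_up {i : ℕ} (h1 : 1 ≤ i) (h2 : i + 1 ≤ P.n - 1) :
      Rel P (fE i * fE (i+1) * fE i) (fE i)
  | EEE_down {i : ℕ} (h1 : 1 ≤ i) (h2 : i + 1 ≤ P.n - 1) :
      Rel P (fE (i+1) * fE i * fE (i+1)) (fE (i+1))
  | E_sq {i : ℕ} (h1 : 1 ≤ i) (h2 : i ≤ P.n - 1) : Rel P (fE i * fE i) (P.A 0 • fE i)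
  | cyclo : Rel P (fY ^ P.k) (∑ i ∈ Finset.range P.k, P.qc i • fY ^ i)
  | braidB (h : 2 ≤ P.n) :
      Rel P (fX 1 * fY * fX 1 * fY) (fY * fX 1 * fY * fX 1)
  | YX_comm {i : ℕ} (h1 : 2 ≤ i) (h2 : i ≤ P.n - 1) : Rel P (fY * fX i) (fX i * fY)
  | YE_comm {i : ℕ} (h1 : 2 ≤ i) (h2 : i ≤ P.n - 1) : Rel P (fY * fE i) (fE i * fY)
  | YXYE (h : 2 ≤ P.n) : Rel P (fY * fX 1 * fY * fE 1) (P.laminv • fE 1)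
  | EYXY (h : 2 ≤ P.n) : Rel P (fE 1 * (fY * fX 1 * fY)) (P.laminv • fE 1)
  | EYE {m : ℕ} (h : 2 ≤ P.n) (hm : m ≤ P.k - 1) :
      Rel P (fE 1 * fY ^ m * fE 1) (P.A m • fE 1)

/-- The cyclotomic BMW algebra `B_n^k(R)`. -/
abbrev Alg (P : Params R) := RingQuot (Rel P)

def pr (P : Params R) : F R →ₐ[R] Alg P := RingQuot.mkAlgHom R (Rel P)

/-- The generator `Y`. -/
def Yg (P : Params R) : Alg P := pr P fY
/-- The generator `Y⁻¹`. -/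
def Ygi (P : Params R) : Alg P := pr P fYi
/-- The generator `Xᵢ`. -/
def Xg (P : Params R) (i : ℕ) : Alg P := pr P (fX i)
/-- The generator `Xᵢ⁻¹`. -/
def Xgi (P : Params R) (i : ℕ) : Alg P := pr P (fXi i)
/-- The generator `eᵢ`. -/
def Eg (P : Params R) (i : ℕ) : Alg P := pr P (fE i)

/-- `X₁ X₂ ⋯ X_m`. -/
def upX (P : Params R) : ℕ → Alg P
  | 0 => 1
  | m + 1 => upX P m * Xg P (m + 1)

/-- `X_m ⋯ X₂ X₁`. -/
def downX (P : Params R) : ℕ → Alg P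
  | 0 => 1
  | m + 1 => Xg P (m + 1) * downX P m

/-- `X₁⁻¹ X₂⁻¹ ⋯ X_m⁻¹`. -/
def upXi (P : Params R) : ℕ → Alg P
  | 0 => 1
  | m + 1 => upXi P m * Xgi P (m + 1)

/-- `X_m⁻¹ ⋯ X₂⁻¹ X₁⁻¹`. -/
def downXi (P : Params R) : ℕ → Alg P
  | 0 => 1
  | m + 1 => Xgi P (m + 1) * downXi P m

/-- `Yᵢ' = X_{i-1} ⋯ X₁ Y X₁ ⋯ X_{i-1}`. -/
def Yp (P : Params R) (i : ℕ) : Alg P := downX P (i - 1) * Yg P * upX P (i - 1)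

/-- `(Yᵢ')⁻¹ = X_{i-1}⁻¹ ⋯ X₁⁻¹ Y⁻¹ X₁⁻¹ ⋯ X_{i-1}⁻¹`. -/
def YpInv (P : Params R) (i : ℕ) : Alg P := downXi P (i - 1) * Ygi P * upXi P (i - 1)

/-- `(Yᵢ')^p` for an integer exponent `p`. -/
def Ypow (P : Params R) (i : ℕ) (p : ℤ) : Alg P :=
  if 0 ≤ p then Yp P i ^ p.toNat else YpInv P i ^ (-p).toNat

/-- `Y^{s 1} (Y₂')^{s 2} ⋯ (Y_m')^{s m}`. -/
def YpowProd (P : Params R) (s : ℕ → ℤ) : ℕ → Alg P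
  | 0 => 1
  | m + 1 => YpowProd P s m * Ypow P (m + 1) (s (m + 1))

/-- The subalgebra `B_l` generated by `Y^{±1}, X₁^{±1}, …, X_{l-1}^{±1}, e₁, …, e_{l-1}`. -/
def Bsub (P : Params R) (l : ℕ) : Subalgebra R (Alg P) :=
  Algebra.adjoin R
    ({Yg P, Ygi P} ∪
      {x | ∃ i, 1 ≤ i ∧ i + 1 ≤ l ∧ (x = Xg P i ∨ x = Xgi P i ∨ x = Eg P i)})

/-- `α_{ijl}^p = (Yᵢ')^p Xᵢ ⋯ X_{j-1} e_j ⋯ e_l`. -/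
def alpha (P : Params R) (i j l : ℕ) (p : ℤ) : Alg P :=
  Ypow P i p * ((List.range' i (j - i)).map fun t => Xg P t).prod *
    ((List.range' j (l + 1 - j)).map fun t => Eg P t).prod

/-- The set `P = {⌊k/2⌋ - (k-1), …, ⌊k/2⌋}` of `k` consecutive integers. -/
def Pset (k : ℕ) : Set ℤ := {p | (↑(k / 2) : ℤ) - ((k : ℤ) - 1) ≤ p ∧ p ≤ (↑(k / 2) : ℤ)}

/-- `α_{i₁,j₁,l-1}^{s₁} ⋯ α_{i_m,j_m,l-2m+1}^{s_m}`. -/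
def alphaChain (P : Params R) (l : ℕ) (ii jj : ℕ → ℕ) (ss : ℕ → ℤ) : ℕ → Alg P
  | 0 => 1
  | m + 1 => alphaChain P l ii jj ss m *
      alpha P (ii (m + 1)) (jj (m + 1)) (l + 1 - 2 * (m + 1)) (ss (m + 1))

/-- `α_{i₁,j₁,l-2}^{s₁} ⋯ α_{i_m,j_m,l-2m}^{s_m}`. -/
def alphaChainBar (P : Params R) (l : ℕ) (ii jj : ℕ → ℕ) (ss : ℕ → ℤ) : ℕ → Alg P
  | 0 => 1
  | m + 1 => alphaChainBar P l ii jj ss m *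
      alpha P (ii (m + 1)) (jj (m + 1)) (l - 2 * (m + 1)) (ss (m + 1))

/-- `E_{l,m} = e_{l-1} e_{l-3} ⋯ e_{l-2m+1}`. -/
def Echain (P : Params R) (l : ℕ) : ℕ → Alg P
  | 0 => 1
  | m + 1 => Echain P l m * Eg P (l + 1 - 2 * (m + 1))

/-- The set `V_{l,m}^g`. -/
def Vg (P : Params R) (l m : ℕ) : Set (Alg P) :=
  {x | ∃ ii jj : ℕ → ℕ, ∃ ss : ℕ → ℤ,
    (∀ t, 1 ≤ t → t ≤ m →
      1 ≤ ii t ∧ ii t ≤ jj t ∧ jj t ≤ l + 1 - 2 * t ∧ ss t ∈ Pset P.k) ∧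
    x = alphaChain P l ii jj ss m}

/-- The set `V_{l,m}`. -/
def V (P : Params R) (l m : ℕ) : Set (Alg P) :=
  {x | ∃ ii jj : ℕ → ℕ, ∃ ss : ℕ → ℤ,
    (∀ t, 1 ≤ t → t ≤ m →
      1 ≤ ii t ∧ ii t ≤ jj t ∧ jj t ≤ l + 1 - 2 * t ∧ ss t ∈ Pset P.k) ∧
    (∀ t, 1 ≤ t → t + 1 ≤ m → ii (t + 1) < ii t) ∧
    x = alphaChain P l ii jj ss m}

/-- The set `V̄_{l,m}`. -/
def Vbar (P : Params R) (l m : ℕ) : Set (Alg P) :=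
  {x | ∃ ii jj : ℕ → ℕ, ∃ ss : ℕ → ℤ,
    (∀ t, 1 ≤ t → t ≤ m →
      1 ≤ ii t ∧ ii t ≤ jj t ∧ jj t ≤ l + 1 - 2 * t ∧ ss t ∈ Pset P.k) ∧
    (∀ t, 1 ≤ t → t + 1 ≤ m → ii (t + 1) < ii t) ∧
    x = alphaChainBar P l ii jj ss m}

end CBMW

open CBMW

section Level

variable {R A : Type} [CommRing R] [Ring A] [Algebra R A]

/-- One level of a BMW tower `B' ≤ B`: the next generators `x`, `e` and the last
Jucys–Murphy type element `z` of `B`. -/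
structure BMWLevel (B' B : Subalgebra R A) (x z : Aˣ) (e : A) (d : R) (l : Rˣ) : Prop where
  le : B' ≤ B
  z_mem : (z : A) ∈ B
  zi_mem : ((z⁻¹ : Aˣ) : A) ∈ B
  skein : (x : A) - ((x⁻¹ : Aˣ) : A) = d • (1 - e)
  xe : (x : A) * e = (l : R) • e
  ex : e * (x : A) = (l : R) • e
  w_comm : ∀ b ∈ B, ((x * z * x : Aˣ) : A) * b = b * ((x * z * x : Aˣ) : A)
  we : ((x * z * x : Aˣ) : A) * e = ((z⁻¹ : Aˣ) : A) * e
  ew : e * ((x * z * x : Aˣ) : A) = e * ((z⁻¹ : Aˣ) : A)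
  ebe : ∀ b ∈ B, ∃ b' ∈ B', e * b * e = b' * e
  e_comm : ∀ b ∈ B', e * b = b * e
  x_comm : ∀ b ∈ B', (x : A) * b = b * (x : A)

/-- The relations between consecutive pairs of generators `x, e` and `y, f`. -/
structure BMWLink (B : Subalgebra R A) (x y : Aˣ) (e f : A) (l a : R) : Prop where
  y_comm : ∀ b ∈ B, (y : A) * b = b * y
  f_comm : ∀ b ∈ B, f * b = b * f
  f_x_y : f * x * y = f * e
  y_x_f : y * x * f = e * f
  e_y_x : e * y * x = e * f
  x_y_e : x * y * e = f * e
  f_e_f : f * e * f = f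
  braid : (y : A) * x * y = x * y * x
  y_f : y * f = l • f
  f_f : f * f = a • f

namespace BMWLink

variable {B : Subalgebra R A} {x y : Aˣ} {e f : A} {l a : R}

theorem y_e_f (k : BMWLink B x y e f l a) :
    y * e * f = ((x⁻¹ : Aˣ) : A) * f := by
  rw [Units.eq_inv_mul_iff_mul_eq, ← mul_assoc, ← mul_assoc, k.x_y_e, k.f_e_f]

theorem f_e_y (k : BMWLink B x y e f l a) :
    f * e * y = f * ((x⁻¹ : Aˣ) : A) := by
  rw [Units.eq_mul_inv_iff_mul_eq, mul_assoc, mul_assoc, ← mul_assoc e, k.e_y_x, ← mul_assoc,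
    k.f_e_f]

theorem y_e_y (k : BMWLink B x y e f l a) :
    y * e * y = ((x⁻¹ : Aˣ) : A) * f * ((x⁻¹ : Aˣ) : A) := by
  rw [Units.eq_mul_inv_iff_mul_eq, ← k.y_e_f, mul_assoc, mul_assoc, ← mul_assoc e, k.e_y_x]
  simp only [mul_assoc]

theorem f_x_f {l : Rˣ} (k : BMWLink B x y e f (l : R) a) :
    f * x * f = ((l⁻¹ : Rˣ) : R) • f := by
  have h1 : f * x * (y * f) = f := by rw [← mul_assoc, k.f_x_y, k.f_e_f]
  rw [k.y_f, mul_smul_comm] at h1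
  calc f * x * f = ((l⁻¹ : Rˣ) : R) • ((l : R) • (f * x * f)) := by
        rw [smul_smul, Units.inv_mul, one_smul]
    _ = _ := by rw [h1]

end BMWLink

namespace BMWLevel

variable {B' B : Subalgebra R A} {x z : Aˣ} {e : A} {d : R} {l : Rˣ}

theorem inv_eq (h : BMWLevel B' B x z e d l) :
    ((x⁻¹ : Aˣ) : A) = x - d • (1 : A) + d • e := by
  have := h.skein
  rw [smul_sub] at this
  rw [sub_eq_iff_eq_add] at this
  rw [this]; abel

theorem xie (h : BMWLevel B' B x z e d l) : ((x⁻¹ : Aˣ) : A) * e = ((l⁻¹ : Rˣ) : R) • e := by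
  have h1 : ((x⁻¹ : Aˣ) : A) * ((x : A) * e) = e := Units.inv_mul_cancel_left x e
  rw [h.xe, mul_smul_comm] at h1
  rw [← h1, smul_smul, Units.inv_mul, one_smul, h1]

theorem exi (h : BMWLevel B' B x z e d l) : e * ((x⁻¹ : Aˣ) : A) = ((l⁻¹ : Rˣ) : R) • e := by
  have h1 : (e * (x : A)) * ((x⁻¹ : Aˣ) : A) = e := Units.mul_inv_cancel_right e x
  rw [h.ex, smul_mul_assoc] at h1
  rw [← h1, smul_smul, Units.inv_mul, one_smul, h1]

theorem sq_eq (h : BMWLevel B' B x z e d l) :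
    (x : A) * x = 1 + d • (x : A) - (d * l) • e := by
  have h1 : (x : A) * ((x⁻¹ : Aˣ) : A) = 1 := Units.mul_inv x
  rw [h.inv_eq, mul_add, mul_sub, mul_smul_comm, mul_smul_comm, mul_one, h.xe, smul_smul] at h1
  rw [← h1]; abel

theorem z_pow_mem (h : BMWLevel B' B x z e d l) (s : ℕ) : (z : A) ^ s ∈ B := pow_mem h.z_mem s

theorem z_zpow_mem (h : BMWLevel B' B x z e d l) (s : ℤ) : ((z ^ s : Aˣ) : A) ∈ B := by
  obtain ⟨n, rfl | rfl⟩ := s.eq_nat_or_neg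
  · simpa using h.z_pow_mem n
  · simpa [← inv_pow] using pow_mem h.zi_mem n

/-- The symmetry inverting the braid generators. -/
theorem swap (h : BMWLevel B' B x z e d l) : BMWLevel B' B x⁻¹ z⁻¹ e (-d) l⁻¹ where
  le := h.le
  z_mem := h.zi_mem
  zi_mem := by simpa using h.z_mem
  skein := by rw [inv_inv, neg_smul, ← h.skein]; abel
  xe := h.xie
  ex := h.exi
  w_comm b hb := by
    have h1 : x⁻¹ * z⁻¹ * x⁻¹ = (x * z * x)⁻¹ := by group
    rw [h1]
    exact (Commute.units_inv_left (h.w_comm b hb : Commute _ _))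
  we := by
    have h1 : x⁻¹ * z⁻¹ * x⁻¹ = (x * z * x)⁻¹ := by group
    rw [h1, inv_inv, Units.inv_mul_eq_iff_eq_mul, ← mul_assoc, h.w_comm _ h.z_mem, mul_assoc,
      h.we, Units.mul_inv_cancel_left]
  ew := by
    have h1 : x⁻¹ * z⁻¹ * x⁻¹ = (x * z * x)⁻¹ := by group
    rw [h1, inv_inv, Units.mul_inv_eq_iff_eq_mul, mul_assoc, ← h.w_comm _ h.z_mem, ← mul_assoc,
      h.ew, Units.inv_mul_cancel_right]
  ebe := h.ebe
  e_comm := h.e_comm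
  x_comm b hb := Commute.units_inv_left (h.x_comm b hb : Commute _ _)

theorem w_mul_inv (x z : Aˣ) (a : A) :
    ((x * z * x : Aˣ) : A) * (((x⁻¹ : Aˣ) : A) * a) = x * (z * a) := by
  simp [mul_assoc]

theorem x_mul_z_pow_e (h : BMWLevel B' B x z e d l) (s : ℕ) :
    ∃ b ∈ B, (x : A) * (z : A) ^ s * e = b * e := by
  induction s with
  | zero => exact ⟨algebraMap R A l, B.algebraMap_mem _, by
      rw [pow_zero, mul_one, h.xe, Algebra.smul_def]⟩
  | succ s ih =>
    obtain ⟨b, hb, ih⟩ := ih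
    obtain ⟨b', hb', he⟩ := h.ebe _ (h.z_pow_mem s)
    refine ⟨b * ((z⁻¹ : Aˣ) : A) - d • ((z : A) ^ s * ((z⁻¹ : Aˣ) : A))
      + d • (b' * ((z⁻¹ : Aˣ) : A)), ?_, ?_⟩
    · exact add_mem (sub_mem (mul_mem hb h.zi_mem)
        (B.smul_mem (mul_mem (h.z_pow_mem s) h.zi_mem) _))
        (B.smul_mem (mul_mem (h.le hb') h.zi_mem) _)
    · have key : ∀ c ∈ B, ((x * z * x : Aˣ) : A) * (c * e) = c * (((z⁻¹ : Aˣ) : A) * e) := by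
        intro c hc
        rw [← mul_assoc, h.w_comm c hc, mul_assoc, h.we]
      have h1 : (x : A) * (z : A) ^ (s + 1) * e
          = ((x * z * x : Aˣ) : A) * (((x⁻¹ : Aˣ) : A) * ((z : A) ^ s * e)) := by
        rw [w_mul_inv, pow_succ']; simp only [mul_assoc]
      rw [h1, h.inv_eq, add_mul, sub_mul, ← mul_assoc (x : A), ih, smul_mul_assoc, one_mul,
        smul_mul_assoc, ← mul_assoc e, he, mul_add, mul_sub, mul_smul_comm, mul_smul_comm,
        key b hb, key _ (h.z_pow_mem s), key b' (h.le hb')]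
      simp only [add_mul, sub_mul, smul_mul_assoc, mul_assoc]

theorem e_mul_z_pow_x (h : BMWLevel B' B x z e d l) (s : ℕ) :
    ∃ b ∈ B, e * (z : A) ^ s * x = e * b := by
  induction s with
  | zero => exact ⟨algebraMap R A l, B.algebraMap_mem _, by
      rw [pow_zero, mul_one, h.ex, ← Algebra.commutes, Algebra.smul_def]⟩
  | succ s ih =>
    obtain ⟨b, hb, ih⟩ := ih
    obtain ⟨b', hb', he⟩ := h.ebe _ (h.z_pow_mem s)
    rw [← h.e_comm b' hb'] at he
    refine ⟨((z⁻¹ : Aˣ) : A) * b - d • (((z⁻¹ : Aˣ) : A) * (z : A) ^ s)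
      + d • (((z⁻¹ : Aˣ) : A) * b'), ?_, ?_⟩
    · exact add_mem (sub_mem (mul_mem h.zi_mem hb)
        (B.smul_mem (mul_mem h.zi_mem (h.z_pow_mem s)) _))
        (B.smul_mem (mul_mem h.zi_mem (h.le hb')) _)
    · have key : ∀ c ∈ B, e * c * ((x * z * x : Aˣ) : A) = e * ((z⁻¹ : Aˣ) : A) * c := by
        intro c hc
        rw [mul_assoc, ← h.w_comm c hc, ← mul_assoc, h.ew]
      have h1 : e * (z : A) ^ (s + 1) * x
          = e * (z : A) ^ s * ((x⁻¹ : Aˣ) : A) * ((x * z * x : Aˣ) : A) := by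
        simp [mul_assoc, pow_succ]
      rw [h1, h.inv_eq, mul_add, mul_sub, ih, mul_smul_comm, mul_one,
        mul_smul_comm, he, add_mul, sub_mul, smul_mul_assoc, smul_mul_assoc,
        key b hb, key _ (h.z_pow_mem s), key b' (h.le hb')]
      simp only [mul_add, mul_sub, mul_smul_comm, mul_assoc]

theorem x_mul_z_zpow_e (h : BMWLevel B' B x z e d l) (s : ℤ) :
    ∃ b ∈ B, (x : A) * ((z ^ s : Aˣ) : A) * e = b * e := by
  obtain ⟨n, rfl | rfl⟩ := s.eq_nat_or_neg
  · simpa using h.x_mul_z_pow_e n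
  · obtain ⟨b, hb, h1⟩ := h.swap.x_mul_z_pow_e n
    obtain ⟨b', hb', he⟩ := h.ebe _ (h.z_zpow_mem (-n))
    have hz : ((z⁻¹ : Aˣ) : A) ^ n = ((z ^ (-n : ℤ) : Aˣ) : A) := by simp
    rw [hz, h.inv_eq, add_mul, add_mul, sub_mul, sub_mul, smul_mul_assoc, smul_mul_assoc, one_mul,
      smul_mul_assoc, smul_mul_assoc, he] at h1
    refine ⟨b + d • ((z ^ (-n : ℤ) : Aˣ) : A) - d • b',
      sub_mem (add_mem hb (B.smul_mem (h.z_zpow_mem _) _)) (B.smul_mem (h.le hb') _), ?_⟩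
    rw [sub_mul, add_mul, ← h1, smul_mul_assoc, smul_mul_assoc]; abel

theorem e_mul_z_zpow_x (h : BMWLevel B' B x z e d l) (s : ℤ) :
    ∃ b ∈ B, e * ((z ^ s : Aˣ) : A) * x = e * b := by
  obtain ⟨n, rfl | rfl⟩ := s.eq_nat_or_neg
  · simpa using h.e_mul_z_pow_x n
  · obtain ⟨b, hb, h1⟩ := h.swap.e_mul_z_pow_x n
    obtain ⟨b', hb', he⟩ := h.ebe _ (h.z_zpow_mem (-n))
    rw [← h.e_comm b' hb'] at he
    have hz : ((z⁻¹ : Aˣ) : A) ^ n = ((z ^ (-n : ℤ) : Aˣ) : A) := by simp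
    rw [hz, h.inv_eq, mul_add, mul_sub, mul_smul_comm, mul_one, mul_smul_comm, he] at h1
    refine ⟨b + d • ((z ^ (-n : ℤ) : Aˣ) : A) - d • b',
      sub_mem (add_mem hb (B.smul_mem (h.z_zpow_mem _) _)) (B.smul_mem (h.le hb') _), ?_⟩
    rw [mul_sub, mul_add, ← h1, mul_smul_comm, mul_smul_comm]; abel

/-- The span of `B`, `B e B`, `B x B` and `w ^ t B` for `t < s`. -/
def filt (B : Subalgebra R A) (x w : Aˣ) (e : A) (s : ℕ) : Submodule R A :=
  Submodule.span R {y | (∃ b ∈ B, ∃ c ∈ B, y = b * c ∨ y = b * e * c ∨ y = b * x * c) ∨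
    ∃ t < s, ∃ c ∈ B, y = (w : A) ^ t * c}

section filt

variable {w : Aˣ} {s : ℕ}

theorem mul_mem_filt {b c : A} (hb : b ∈ B) (hc : c ∈ B) : b * c ∈ filt B x w e s :=
  Submodule.subset_span (Or.inl ⟨b, hb, c, hc, Or.inl rfl⟩)

theorem mul_e_mul_mem_filt {b c : A} (hb : b ∈ B) (hc : c ∈ B) : b * e * c ∈ filt B x w e s :=
  Submodule.subset_span (Or.inl ⟨b, hb, c, hc, Or.inr (Or.inl rfl)⟩)

theorem mul_x_mul_mem_filt {b c : A} (hb : b ∈ B) (hc : c ∈ B) : b * x * c ∈ filt B x w e s :=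
  Submodule.subset_span (Or.inl ⟨b, hb, c, hc, Or.inr (Or.inr rfl)⟩)

theorem pow_mul_mem_filt {t : ℕ} (ht : t < s) {c : A} (hc : c ∈ B) :
    (w : A) ^ t * c ∈ filt B x w e s :=
  Submodule.subset_span (Or.inr ⟨t, ht, c, hc, rfl⟩)

theorem filt_le {N : Submodule R A} (h1 : ∀ b ∈ B, ∀ c ∈ B, b * c ∈ N)
    (h2 : ∀ b ∈ B, ∀ c ∈ B, b * e * c ∈ N) (h3 : ∀ b ∈ B, ∀ c ∈ B, b * x * c ∈ N)
    (h4 : ∀ t < s, ∀ c ∈ B, (w : A) ^ t * c ∈ N) : filt B x w e s ≤ N := by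
  rw [filt, Submodule.span_le]
  rintro y (⟨b, hb, c, hc, rfl | rfl | rfl⟩ | ⟨t, ht, c, hc, rfl⟩)
  exacts [h1 b hb c hc, h2 b hb c hc, h3 b hb c hc, h4 t ht c hc]

theorem filt_mono {s s' : ℕ} (hs : s ≤ s') : filt B x w e s ≤ filt B x w e s' :=
  filt_le (fun _ hb _ hc => mul_mem_filt hb hc) (fun _ hb _ hc => mul_e_mul_mem_filt hb hc)
    (fun _ hb _ hc => mul_x_mul_mem_filt hb hc)
    (fun _ ht _ hc => pow_mul_mem_filt (ht.trans_le hs) hc)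

theorem filt_mul_mem {y c : A} (hy : y ∈ filt B x w e s) (hc : c ∈ B) :
    y * c ∈ filt B x w e s := by
  have : filt B x w e s ≤ (filt B x w e s).comap (LinearMap.mulRight R c) := by
    refine filt_le (fun b hb b' hb' => ?_) (fun b hb b' hb' => ?_) (fun b hb b' hb' => ?_)
      (fun t ht b' hb' => ?_) <;>
    simp only [Submodule.mem_comap, LinearMap.mulRight_apply, mul_assoc _ b' c]
    exacts [mul_mem_filt hb (mul_mem hb' hc), mul_e_mul_mem_filt hb (mul_mem hb' hc),
      mul_x_mul_mem_filt hb (mul_mem hb' hc), pow_mul_mem_filt ht (mul_mem hb' hc)]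
  exact this hy

end filt

theorem w_mul_mem_filt (h : BMWLevel B' B x z e d l) {s : ℕ} (hs : 1 ≤ s) {y : A}
    (hy : y ∈ filt B x (x * z * x) e s) :
    ((x * z * x : Aˣ) : A) * y ∈ filt B x (x * z * x) e (s + 1) := by
  have hw : ∀ c ∈ B, ((x * z * x : Aˣ) : A) * c ∈ filt B x (x * z * x) e (s + 1) := fun c hc => by
    simpa using pow_mul_mem_filt (B := B) (x := x) (w := x * z * x) (e := e) (t := 1)
      (s := s + 1) (by omega) hc
  have : filt B x (x * z * x) e s ≤ (filt B x (x * z * x) e (s + 1)).comap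
      (LinearMap.mulLeft R ((x * z * x : Aˣ) : A)) := by
    refine filt_le (fun b hb c hc => ?_) (fun b hb c hc => ?_) (fun b hb c hc => ?_)
      (fun t ht c hc => ?_) <;>
    simp only [Submodule.mem_comap, LinearMap.mulLeft_apply]
    · exact hw _ (mul_mem hb hc)
    · rw [← mul_assoc, ← mul_assoc, h.w_comm b hb, mul_assoc b, h.we, ← mul_assoc]
      exact mul_e_mul_mem_filt (mul_mem hb h.zi_mem) hc
    · obtain ⟨b', hb', he⟩ := h.x_mul_z_pow_e 1
      rw [pow_one] at he
      have h1 : ((x * z * x : Aˣ) : A) * (b * x * c) = b * (x * z) * (x * x) * c := by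
        rw [← mul_assoc, ← mul_assoc, h.w_comm b hb]; simp [mul_assoc]
      have h2 : ((x * z * x : Aˣ) : A) * (b * c) = b * (x * z) * x * c := by
        rw [← mul_assoc, h.w_comm b hb]; simp [mul_assoc]
      have h3 : ((x * z * x : Aˣ) : A) * (b * x * c) = b * x * (z * c)
          + d • (((x * z * x : Aˣ) : A) * (b * c)) - (d * l) • ((b * b') * e * c) := by
        rw [h1, h2, h.sq_eq, mul_sub, mul_add, mul_one, mul_smul_comm, mul_smul_comm,
          mul_assoc b _ e, he]
        simp only [add_mul, sub_mul, smul_mul_assoc, mul_assoc]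
      rw [h3]
      exact sub_mem (add_mem (mul_x_mul_mem_filt hb (mul_mem h.z_mem hc))
        (Submodule.smul_mem _ _ (hw _ (mul_mem hb hc))))
        (Submodule.smul_mem _ _ (mul_e_mul_mem_filt (mul_mem hb hb') hc))
    · rw [← mul_assoc, ← pow_succ']
      exact pow_mul_mem_filt (by omega) hc
  exact this hy

theorem x_mul_z_pow_mul_x_sub_mem (h : BMWLevel B' B x z e d l) (s : ℕ) :
    (x : A) * (z : A) ^ s * x - ((x * z * x : Aˣ) : A) ^ s ∈ filt B x (x * z * x) e s := by
  rcases Nat.eq_zero_or_pos s with rfl | hs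
  · have h1 : (x : A) * (z : A) ^ 0 * x - ((x * z * x : Aˣ) : A) ^ 0
        = d • (1 * x * 1) - (d * l) • (1 * e * 1) := by
      simp only [pow_zero, mul_one, one_mul, h.sq_eq]; abel
    rw [h1]
    exact sub_mem (Submodule.smul_mem _ _ (mul_x_mul_mem_filt (one_mem B) (one_mem B)))
      (Submodule.smul_mem _ _ (mul_e_mul_mem_filt (one_mem B) (one_mem B)))
  induction s, hs using Nat.le_induction with
  | base => simp
  | succ s hs ih =>
    obtain ⟨b, hb, he⟩ := h.e_mul_z_pow_x s
    have h1 : (x : A) * (z : A) ^ (s + 1) * x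
        = ((x * z * x : Aˣ) : A) * (((x⁻¹ : Aˣ) : A) * ((z : A) ^ s * x)) := by
      rw [w_mul_inv, pow_succ']; simp only [mul_assoc]
    have h2 : (x : A) * (z : A) ^ (s + 1) * x - ((x * z * x : Aˣ) : A) ^ (s + 1)
        = ((x * z * x : Aˣ) : A) * ((x : A) * (z : A) ^ s * x - ((x * z * x : Aˣ) : A) ^ s)
          - d • (((x * z * x : Aˣ) : A) * ((z : A) ^ s * x * 1))
          + d • (((x * z * x : Aˣ) : A) * (1 * e * b)) := by
      rw [h1, h.inv_eq, one_mul, ← he, add_mul, sub_mul, smul_mul_assoc, smul_mul_assoc, one_mul,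
        mul_add, mul_sub, mul_sub, ← pow_succ', mul_smul_comm, mul_smul_comm]
      simp only [mul_assoc, mul_one]; abel
    rw [h2]
    have h3 : filt B x (x * z * x) e (1 + 1) ≤ filt B x (x * z * x) e (s + 1) :=
      filt_mono (by omega)
    exact add_mem (sub_mem (h.w_mul_mem_filt hs ih) (Submodule.smul_mem _ _ (h3
      (h.w_mul_mem_filt le_rfl (mul_x_mul_mem_filt (h.z_pow_mem s) (one_mem B))))))
      (Submodule.smul_mem _ _ (h3
        (h.w_mul_mem_filt le_rfl (mul_e_mul_mem_filt (one_mem B) hb))))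

/-- To control the images of all `w ^ s c`, it suffices to control those of `x z ^ s x c`. -/
theorem map_w_pow_mul_mem (h : BMWLevel B' B x z e d l) (f : A →ₗ[R] A) {N : Submodule R A}
    (h1 : ∀ b ∈ B, ∀ c ∈ B, f (b * c) ∈ N) (h2 : ∀ b ∈ B, ∀ c ∈ B, f (b * e * c) ∈ N)
    (h3 : ∀ b ∈ B, ∀ c ∈ B, f (b * x * c) ∈ N)
    (h4 : ∀ s : ℕ, ∀ c ∈ B, f (x * (z : A) ^ s * x * c) ∈ N) (s : ℕ) :
    ∀ c ∈ B, f (((x * z * x : Aˣ) : A) ^ s * c) ∈ N := by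
  induction s using Nat.strong_induction_on with
  | _ s ih =>
    intro c hc
    have h5 : filt B x (x * z * x) e s ≤ N.comap f := filt_le h1 h2 h3 ih
    have h6 := h5 (filt_mul_mem (h.x_mul_z_pow_mul_x_sub_mem s) hc)
    rw [Submodule.mem_comap, sub_mul, map_sub] at h6
    simpa using sub_mem (h4 s c hc) h6

/-- The span of `B e B`, `B x B` and `w ^ t B` for `t ∈ S`. -/
def window (B : Subalgebra R A) (x w : Aˣ) (e : A) (S : Set ℤ) : Submodule R A :=
  Submodule.span R {y | (∃ b ∈ B, ∃ c ∈ B, y = b * e * c ∨ y = b * x * c) ∨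
    ∃ t ∈ S, ∃ c ∈ B, y = ((w ^ t : Aˣ) : A) * c}

section window

variable {w : Aˣ} {S : Set ℤ}

theorem mul_e_mul_mem_window {b c : A} (hb : b ∈ B) (hc : c ∈ B) :
    b * e * c ∈ window B x w e S :=
  Submodule.subset_span (Or.inl ⟨b, hb, c, hc, Or.inl rfl⟩)

theorem mul_x_mul_mem_window {b c : A} (hb : b ∈ B) (hc : c ∈ B) :
    b * x * c ∈ window B x w e S :=
  Submodule.subset_span (Or.inl ⟨b, hb, c, hc, Or.inr rfl⟩)

theorem zpow_mul_mem_window {t : ℤ} (ht : t ∈ S) {c : A} (hc : c ∈ B) :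
    ((w ^ t : Aˣ) : A) * c ∈ window B x w e S :=
  Submodule.subset_span (Or.inr ⟨t, ht, c, hc, rfl⟩)

theorem mem_window_of_mem (hS : 0 ∈ S) {c : A} (hc : c ∈ B) : c ∈ window B x w e S := by
  simpa using zpow_mul_mem_window (B := B) (x := x) (w := w) (e := e) hS hc

theorem window_le {N : Submodule R A} (h2 : ∀ b ∈ B, ∀ c ∈ B, b * e * c ∈ N)
    (h3 : ∀ b ∈ B, ∀ c ∈ B, b * x * c ∈ N)
    (h4 : ∀ t ∈ S, ∀ c ∈ B, ((w ^ t : Aˣ) : A) * c ∈ N) : window B x w e S ≤ N := by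
  rw [window, Submodule.span_le]
  rintro y (⟨b, hb, c, hc, rfl | rfl⟩ | ⟨t, ht, c, hc, rfl⟩)
  exacts [h2 b hb c hc, h3 b hb c hc, h4 t ht c hc]

theorem window_mul_mem {y c : A} (hy : y ∈ window B x w e S) (hc : c ∈ B) :
    y * c ∈ window B x w e S := by
  have : window B x w e S ≤ (window B x w e S).comap (LinearMap.mulRight R c) := by
    refine window_le (fun b hb b' hb' => ?_) (fun b hb b' hb' => ?_)
      (fun t ht b' hb' => ?_) <;>
    simp only [Submodule.mem_comap, LinearMap.mulRight_apply, mul_assoc _ b' c]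
    exacts [mul_e_mul_mem_window hb (mul_mem hb' hc),
      mul_x_mul_mem_window hb (mul_mem hb' hc), zpow_mul_mem_window ht (mul_mem hb' hc)]
  exact this hy

end window

theorem mul_mem_window (h : BMWLevel B' B x z e d l) {S : Set ℤ} {y b : A} (hb : b ∈ B)
    (hy : y ∈ window B x (x * z * x) e S) : b * y ∈ window B x (x * z * x) e S := by
  have : window B x (x * z * x) e S ≤
      (window B x (x * z * x) e S).comap (LinearMap.mulLeft R b) := by
    refine window_le (fun a ha c hc => ?_) (fun a ha c hc => ?_)
      (fun t ht c hc => ?_) <;>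
    simp only [Submodule.mem_comap, LinearMap.mulLeft_apply, ← mul_assoc]
    · exact mul_e_mul_mem_window (mul_mem hb ha) hc
    · exact mul_x_mul_mem_window (mul_mem hb ha) hc
    · have h1 : Commute (((x * z * x) ^ t : Aˣ) : A) b :=
        Commute.units_zpow_left (h.w_comm b hb : Commute _ _) t
      rw [← h1.eq, mul_assoc _ b c]
      exact zpow_mul_mem_window ht (mul_mem hb hc)
  exact this hy

theorem mul_xi_mul_mem_window (h : BMWLevel B' B x z e d l) {w : Aˣ} {S : Set ℤ} (hS : 0 ∈ S)
    {b c : A} (hb : b ∈ B) (hc : c ∈ B) :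
    b * ((x⁻¹ : Aˣ) : A) * c ∈ window B x w e S := by
  rw [h.inv_eq]
  have h1 : b * ((x : A) - d • (1 : A) + d • e) * c = b * x * c - d • (b * c) + d • (b * e * c) := by
    simp only [mul_add, mul_sub, add_mul, sub_mul, mul_smul_comm, smul_mul_assoc, mul_one]
  rw [h1]
  exact add_mem (sub_mem (mul_x_mul_mem_window hb hc)
    (Submodule.smul_mem _ _ (mem_window_of_mem hS (mul_mem hb hc))))
    (Submodule.smul_mem _ _ (mul_e_mul_mem_window hb hc))

theorem e_mul_w_zpow (h : BMWLevel B' B x z e d l) (t : ℤ) :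
    e * (((x * z * x) ^ t : Aˣ) : A) = e * ((z ^ (-t) : Aˣ) : A) := by
  have aux : ∀ {x z : Aˣ} {d : R} {l : Rˣ}, BMWLevel B' B x z e d l → ∀ n : ℕ,
      e * (((x * z * x) ^ n : Aˣ) : A) = e * (((z⁻¹) ^ n : Aˣ) : A) := by
    intro x z d l h n
    induction n with
    | zero => simp
    | succ n ih =>
      rw [pow_succ, Units.val_mul, ← mul_assoc, ih, mul_assoc, ← h.w_comm, ← mul_assoc, h.ew,
        pow_succ', Units.val_mul, mul_assoc]
      simpa using pow_mem h.zi_mem n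
  obtain ⟨n, rfl | rfl⟩ := t.eq_nat_or_neg
  · simpa using aux h n
  · have h1 : x⁻¹ * z⁻¹ * x⁻¹ = (x * z * x)⁻¹ := by group
    have := aux h.swap n
    rw [h1] at this
    simpa using this

/-- `B` is spanned by `z ^ s B'` for `s ∈ S` together with elements which interact with `x` and
`e` in a controlled way. -/
def Decomposes (B' B : Subalgebra R A) (x z : Aˣ) (e : A) (S : Set ℤ) : Prop :=
  ∀ b ∈ B, b ∈ Submodule.span R ({g | (∃ b ∈ B, x * g * e = b * e) ∧ (∃ b ∈ B, e * g * x = e * b) ∧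
    x * g * x ∈ filt B x 1 e 0} ∪ {y | ∃ s ∈ S, ∃ b' ∈ B', y = ((z ^ s : Aˣ) : A) * b'})

section Decomposes

variable {S : Set ℤ}

theorem x_mul_mul_e (h : BMWLevel B' B x z e d l) (hB : Decomposes B' B x z e S) :
    ∀ b ∈ B, ∃ b' ∈ B, x * b * e = b' * e := by
  intro b hb
  have hb' := hB b hb
  clear hb
  induction hb' using Submodule.span_induction with
  | mem y hy =>
    obtain hy | ⟨s, -, b', hb', rfl⟩ := hy
    · exact hy.1
    · obtain ⟨c, hc, he⟩ := h.x_mul_z_zpow_e s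
      refine ⟨c * b', mul_mem hc (h.le hb'), ?_⟩
      rw [← mul_assoc, mul_assoc, ← h.e_comm b' hb', ← mul_assoc, he, mul_assoc,
        h.e_comm b' hb', mul_assoc]
  | zero => exact ⟨0, zero_mem _, by simp⟩
  | add y y' _ _ h1 h2 =>
    obtain ⟨c, hc, h1⟩ := h1
    obtain ⟨c', hc', h2⟩ := h2
    exact ⟨c + c', add_mem hc hc', by rw [mul_add, add_mul, h1, h2, add_mul]⟩
  | smul r y _ h1 =>
    obtain ⟨c, hc, h1⟩ := h1
    exact ⟨r • c, B.smul_mem hc r, by rw [mul_smul_comm, smul_mul_assoc, h1, smul_mul_assoc]⟩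

theorem e_mul_mul_x (h : BMWLevel B' B x z e d l) (hB : Decomposes B' B x z e S) :
    ∀ b ∈ B, ∃ b' ∈ B, e * b * x = e * b' := by
  intro b hb
  have hb' := hB b hb
  clear hb
  induction hb' using Submodule.span_induction with
  | mem y hy =>
    obtain hy | ⟨s, -, b', hb', rfl⟩ := hy
    · exact hy.2.1
    · obtain ⟨c, hc, he⟩ := h.e_mul_z_zpow_x s
      refine ⟨c * b', mul_mem hc (h.le hb'), ?_⟩
      rw [← mul_assoc, mul_assoc, ← h.x_comm b' hb', ← mul_assoc, he, mul_assoc]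
  | zero => exact ⟨0, zero_mem _, by simp⟩
  | add y y' _ _ h1 h2 =>
    obtain ⟨c, hc, h1⟩ := h1
    obtain ⟨c', hc', h2⟩ := h2
    exact ⟨c + c', add_mem hc hc', by rw [mul_add, add_mul, h1, h2, mul_add]⟩
  | smul r y _ h1 =>
    obtain ⟨c, hc, h1⟩ := h1
    exact ⟨r • c, B.smul_mem hc r, by rw [mul_smul_comm, smul_mul_assoc, h1, mul_smul_comm]⟩

theorem x_mul_z_zpow_mul_x_mem (h : BMWLevel B' B x z e d l) {p q : ℤ} (hp : p ≤ 0) (hq : 0 ≤ q)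
    {s : ℤ} (hs : s ∈ Set.Icc p q) :
    x * ((z ^ s : Aˣ) : A) * x ∈ window B x (x * z * x) e (Set.Icc p q) := by
  have h0 : (0 : ℤ) ∈ Set.Icc p q := ⟨hp, hq⟩
  obtain ⟨n, rfl | rfl⟩ := s.eq_nat_or_neg
  · have h1 : filt B x (x * z * x) e n ≤ window B x (x * z * x) e (Set.Icc p q) := by
      refine filt_le (fun b hb c hc => mem_window_of_mem h0 (mul_mem hb hc))
        (fun b hb c hc => mul_e_mul_mem_window hb hc)
        (fun b hb c hc => mul_x_mul_mem_window hb hc) (fun t ht c hc => ?_)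
      have h3 : (t : ℤ) ∈ Set.Icc p q := ⟨by omega, by have := hs.2; omega⟩
      simpa using zpow_mul_mem_window (B := B) (x := x) (w := x * z * x) (e := e) h3 hc
    have h2 := zpow_mul_mem_window (B := B) (x := x) (w := x * z * x) (e := e) hs (one_mem B)
    have h3 := add_mem (h1 (h.x_mul_z_pow_mul_x_sub_mem n)) h2
    simpa using h3
  · have hw : x⁻¹ * z⁻¹ * x⁻¹ = (x * z * x)⁻¹ := by group
    have h1 : filt B x⁻¹ (x⁻¹ * z⁻¹ * x⁻¹) e n ≤ window B x (x * z * x) e (Set.Icc p q) := by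
      refine filt_le (fun b hb c hc => mem_window_of_mem h0 (mul_mem hb hc))
        (fun b hb c hc => mul_e_mul_mem_window hb hc)
        (fun b hb c hc => h.mul_xi_mul_mem_window h0 hb hc) (fun t ht c hc => ?_)
      have h3 : (-t : ℤ) ∈ Set.Icc p q := ⟨by have := hs.1; omega, by omega⟩
      have h4 := zpow_mul_mem_window (B := B) (x := x) (w := x * z * x) (e := e) h3 hc
      rw [hw, ← Units.val_pow_eq_pow_val]
      simpa using h4
    have h2 := zpow_mul_mem_window (B := B) (x := x) (w := x * z * x) (e := e) hs (one_mem B)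
    have h3 := add_mem (h1 (h.swap.x_mul_z_pow_mul_x_sub_mem n)) h2
    have hz : ((z⁻¹ : Aˣ) : A) ^ n = ((z ^ (-n : ℤ) : Aˣ) : A) := by simp
    have hz' := h.z_zpow_mem (-n)
    rw [hw, hz, ← Units.val_pow_eq_pow_val, zpow_neg, zpow_natCast, mul_one, inv_pow,
      zpow_neg, zpow_natCast, sub_add_cancel, ← zpow_natCast, ← zpow_neg] at h3
    obtain ⟨b, hb, he⟩ := h.e_mul_z_zpow_x (-n)
    have h4 : x * ((z ^ (-n : ℤ) : Aˣ) : A) * x =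
        ((x⁻¹ : Aˣ) : A) * ((z ^ (-n : ℤ) : Aˣ) : A) * ((x⁻¹ : Aˣ) : A)
        + d • (1 * ((x⁻¹ : Aˣ) : A) * ((z ^ (-n : ℤ) : Aˣ) : A))
        - d • (((x⁻¹ : Aˣ) : A) * ((z ^ (-n : ℤ) : Aˣ) : A) * e)
        + d • (((z ^ (-n : ℤ) : Aˣ) : A) * x * 1) - d • (1 * e * b) := by
      rw [one_mul e, ← he, h.inv_eq]
      simp only [mul_add, mul_sub, add_mul, sub_mul, mul_smul_comm, smul_mul_assoc, mul_one,
        one_mul, smul_add, smul_sub]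
      abel
    obtain ⟨b', hb', he'⟩ := h.swap.x_mul_z_zpow_e n
    have hz2 : (((z⁻¹) ^ (n : ℤ) : Aˣ) : A) = ((z ^ (-n : ℤ) : Aˣ) : A) := by simp
    rw [hz2] at he'
    rw [h4]
    refine sub_mem (add_mem (sub_mem (add_mem h3 (Submodule.smul_mem _ _ ?_))
      (Submodule.smul_mem _ _ ?_)) (Submodule.smul_mem _ _ ?_)) (Submodule.smul_mem _ _ ?_)
    · exact h.mul_xi_mul_mem_window h0 (one_mem B) hz'
    · rw [he', ← mul_one (b' * e)]
      exact mul_e_mul_mem_window hb' (one_mem B)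
    · exact mul_x_mul_mem_window hz' (one_mem B)
    · exact mul_e_mul_mem_window (one_mem B) hb

theorem x_mul_mul_x_mem (h : BMWLevel B' B x z e d l) {p q : ℤ} (hp : p ≤ 0) (hq : 0 ≤ q)
    (hB : Decomposes B' B x z e (Set.Icc p q)) :
    ∀ b ∈ B, x * b * x ∈ window B x (x * z * x) e (Set.Icc p q) := by
  intro b hb
  have h0 : (0 : ℤ) ∈ Set.Icc p q := ⟨hp, hq⟩
  have hb' := hB b hb
  clear hb
  induction hb' using Submodule.span_induction with
  | mem y hy =>
    obtain hy | ⟨s, hs, b', hb', rfl⟩ := hy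
    · refine filt_le (fun b hb c hc => mem_window_of_mem h0 (mul_mem hb hc))
        (fun b hb c hc => mul_e_mul_mem_window hb hc)
        (fun b hb c hc => mul_x_mul_mem_window hb hc) (fun t ht c hc => ?_) hy.2.2
      omega
    · rw [← mul_assoc (x : A), mul_assoc _ b' (x : A), ← h.x_comm b' hb', ← mul_assoc _ (x : A) b']
      exact window_mul_mem (h.x_mul_z_zpow_mul_x_mem hp hq hs) (h.le hb')
  | zero => simp
  | add y y' _ _ h1 h2 => rw [mul_add, add_mul]; exact add_mem h1 h2
  | smul r y _ h1 => rw [mul_smul_comm, smul_mul_assoc]; exact Submodule.smul_mem _ _ h1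

theorem e_mul_mem_window (h : BMWLevel B' B x z e d l) (hB : Decomposes B' B x z e S) {y : A}
    (hy : y ∈ window B x (x * z * x) e S) : e * y ∈ window B x (x * z * x) e S := by
  have : window B x (x * z * x) e S ≤
      (window B x (x * z * x) e S).comap (LinearMap.mulLeft R e) := by
    refine window_le (fun b hb c hc => ?_) (fun b hb c hc => ?_)
      (fun t ht c hc => ?_) <;>
    simp only [Submodule.mem_comap, LinearMap.mulLeft_apply, ← mul_assoc]
    · obtain ⟨b', hb', he⟩ := h.ebe b hb
      rw [he]
      exact mul_e_mul_mem_window (h.le hb') hc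
    · obtain ⟨b', hb', he⟩ := h.e_mul_mul_x hB b hb
      rw [he, mul_assoc e b' c]
      simpa using mul_e_mul_mem_window (one_mem B) (mul_mem hb' hc)
    · rw [h.e_mul_w_zpow, mul_assoc e _ c]
      simpa using mul_e_mul_mem_window (x := x) (w := x * z * x) (e := e) (S := S) (one_mem B)
        (mul_mem (h.z_zpow_mem (-t)) hc)
  exact this hy

theorem x_mul_mem_window (h : BMWLevel B' B x z e d l) {p q : ℤ} (hp : p ≤ 0) (hq : 0 ≤ q)
    (hB : Decomposes B' B x z e (Set.Icc p q)) {y : A}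
    (hy : y ∈ window B x (x * z * x) e (Set.Icc p q)) :
    x * y ∈ window B x (x * z * x) e (Set.Icc p q) := by
  have h0 : (0 : ℤ) ∈ Set.Icc p q := ⟨hp, hq⟩
  set W := window B x (x * z * x) e (Set.Icc p q) with hW
  have he : ∀ b ∈ B, ∀ c ∈ B, x * (b * e * c) ∈ W := fun b hb c hc => by
    obtain ⟨b', hb', he⟩ := h.x_mul_mul_e hB b hb
    rw [← mul_assoc, ← mul_assoc, he]
    exact mul_e_mul_mem_window hb' hc
  have hx : ∀ b ∈ B, ∀ c ∈ B, x * (b * x * c) ∈ W := fun b hb c hc => by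
    rw [← mul_assoc, ← mul_assoc]
    exact window_mul_mem (h.x_mul_mul_x_mem hp hq hB b hb) hc
  have h1 : ∀ b ∈ B, ∀ c ∈ B, x * (b * c) ∈ W := fun b hb c hc => by
    rw [← one_mul (x : A)]
    exact mul_x_mul_mem_window (one_mem B) (mul_mem hb hc)
  have hxi : ∀ y : A, y ∈ W → x * y ∈ W → ((x⁻¹ : Aˣ) : A) * y ∈ W := fun y hy hxy => by
    rw [h.inv_eq, add_mul, sub_mul, smul_mul_assoc, smul_mul_assoc, one_mul]
    exact add_mem (sub_mem hxy (W.smul_mem _ hy)) (W.smul_mem _ (h.e_mul_mem_window hB hy))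
  have hpow := h.map_w_pow_mul_mem (LinearMap.mulLeft R ((x⁻¹ : Aˣ) : A)) (N := W)
    (fun b hb c hc => hxi _ (mem_window_of_mem h0 (mul_mem hb hc)) (h1 b hb c hc))
    (fun b hb c hc => hxi _ (mul_e_mul_mem_window hb hc) (he b hb c hc))
    (fun b hb c hc => hxi _ (mul_x_mul_mem_window hb hc) (hx b hb c hc))
    (fun s c hc => by
      simp only [LinearMap.mulLeft_apply, mul_assoc, Units.inv_mul_cancel_left]
      rw [← mul_assoc]
      exact mul_x_mul_mem_window (h.z_pow_mem s) hc)
  have hpow' := h.swap.map_w_pow_mul_mem (LinearMap.mulLeft R (x : A)) (N := W) h1 he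
    (fun b hb c hc => by
      have h2 : x * (b * ((x⁻¹ : Aˣ) : A) * c) = x * (b * x * c) - d • (x * (b * c))
          + d • (x * (b * e * c)) := by
        rw [h.inv_eq]
        simp only [mul_add, mul_sub, add_mul, sub_mul, mul_smul_comm, smul_mul_assoc, mul_one]
      simp only [LinearMap.mulLeft_apply]
      rw [h2]
      exact add_mem (sub_mem (hx b hb c hc) (W.smul_mem _ (h1 b hb c hc)))
        (W.smul_mem _ (he b hb c hc)))
    (fun s c hc => by
      simp only [LinearMap.mulLeft_apply, mul_assoc, Units.mul_inv_cancel_left]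
      rw [← mul_assoc]
      exact h.mul_xi_mul_mem_window h0 (h.swap.z_pow_mem s) hc)
  have hw : x⁻¹ * z⁻¹ * x⁻¹ = (x * z * x)⁻¹ := by group
  have : W ≤ W.comap (LinearMap.mulLeft R (x : A)) := by
    refine window_le he hx fun t ht c hc => ?_
    simp only [Submodule.mem_comap, LinearMap.mulLeft_apply]
    have hm : (((x * z * x) ^ t : Aˣ) : A) * c ∈ W := zpow_mul_mem_window ht hc
    obtain ⟨n, rfl | rfl⟩ := t.eq_nat_or_neg
    · have h3 : (x : A) = ((x⁻¹ : Aˣ) : A) + d • (1 : A) - d • e := by rw [h.inv_eq]; abel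
      rw [h3, sub_mul, add_mul, smul_mul_assoc, smul_mul_assoc, one_mul]
      refine sub_mem (add_mem ?_ (W.smul_mem _ hm)) (W.smul_mem _ (h.e_mul_mem_window hB hm))
      simpa using hpow n c hc
    · have h3 := hpow' n c hc
      rw [hw, ← Units.val_pow_eq_pow_val] at h3
      simpa using h3
  exact this hy

end Decomposes

theorem window_induction (h : BMWLevel B' B x z e d l) {N : Submodule R A}
    (h1 : ∀ b ∈ B, ∀ c ∈ B, b * c ∈ N) (h2 : ∀ b ∈ B, ∀ c ∈ B, b * e * c ∈ N)
    (h3 : ∀ b ∈ B, ∀ c ∈ B, b * x * c ∈ N)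
    (h4 : ∀ b ∈ B, ∀ c ∈ B, x * b * ((x⁻¹ : Aˣ) : A) * c ∈ N) (S : Set ℤ) :
    window B x (x * z * x) e S ≤ N := by
  have hxi : ∀ b ∈ B, ∀ c ∈ B, b * ((x⁻¹ : Aˣ) : A) * c ∈ N := fun b hb c hc => by
    have h5 : b * ((x⁻¹ : Aˣ) : A) * c = b * x * c - d • (b * c) + d • (b * e * c) := by
      rw [h.inv_eq]
      simp only [mul_add, mul_sub, add_mul, sub_mul, mul_smul_comm, smul_mul_assoc, mul_one]
    rw [h5]
    exact add_mem (sub_mem (h3 b hb c hc) (N.smul_mem _ (h1 b hb c hc)))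
      (N.smul_mem _ (h2 b hb c hc))
  have hpow := h.map_w_pow_mul_mem LinearMap.id (N := N) h1 h2 h3 (fun s c hc => by
    obtain ⟨b, hb, he⟩ := h.x_mul_z_pow_e s
    have h5 : x * (z : A) ^ s * x * c = x * (z : A) ^ s * ((x⁻¹ : Aˣ) : A) * c
        + d • (1 * x * ((z : A) ^ s * c)) - d • (b * e * c) := by
      rw [← he, h.inv_eq]
      simp only [mul_add, mul_sub, add_mul, sub_mul, mul_smul_comm, smul_mul_assoc, mul_one,
        one_mul, mul_assoc]
      abel
    rw [LinearMap.id_apply, h5]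
    exact sub_mem (add_mem (h4 _ (h.z_pow_mem s) c hc) (N.smul_mem _
      (h3 1 (one_mem B) _ (mul_mem (h.z_pow_mem s) hc)))) (N.smul_mem _ (h2 b hb c hc)))
  have hpow' := h.swap.map_w_pow_mul_mem LinearMap.id (N := N) h1 h2 hxi (fun s c hc => by
    obtain ⟨b, hb, he⟩ := h.swap.e_mul_z_pow_x s
    have h5 : ((x⁻¹ : Aˣ) : A) * ((z⁻¹ : Aˣ) : A) ^ s * ((x⁻¹ : Aˣ) : A) * c =
        x * ((z⁻¹ : Aˣ) : A) ^ s * ((x⁻¹ : Aˣ) : A) * c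
        - d • (((z⁻¹ : Aˣ) : A) ^ s * ((x⁻¹ : Aˣ) : A) * c) + d • (1 * e * (b * c)) := by
      rw [one_mul, ← mul_assoc e, ← he]
      nth_rw 1 [h.inv_eq]
      simp only [add_mul, sub_mul, smul_mul_assoc, one_mul]
    rw [LinearMap.id_apply, h5]
    exact add_mem (sub_mem (h4 _ (h.swap.z_pow_mem s) c hc) (N.smul_mem _
      (hxi _ (h.swap.z_pow_mem s) c hc))) (N.smul_mem _ (h2 1 (one_mem B) _ (mul_mem hb hc))))
  refine window_le h2 h3 fun t _ c hc => ?_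
  have hw : x⁻¹ * z⁻¹ * x⁻¹ = (x * z * x)⁻¹ := by group
  obtain ⟨n, rfl | rfl⟩ := t.eq_nat_or_neg
  · simpa using hpow n c hc
  · have h3 := hpow' n c hc
    rw [hw, ← Units.val_pow_eq_pow_val] at h3
    simpa using h3

section BMWLink

variable {y : Aˣ} {f : A} {a : R} {B₁ : Subalgebra R A} {S : Set ℤ}

theorem next_ebe (h : BMWLevel B' B x z e d l) (k : BMWLink B x y e f l a)
    (hB₁ : ∀ b ∈ B₁, b ∈ window B x (x * z * x) e S) :
    ∀ b ∈ B₁, ∃ c ∈ B, f * b * f = c * f := by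
  let N : Submodule R A := (LinearMap.range (LinearMap.mulRight R f ∘ₗ
    B.toSubmodule.subtype)).comap (LinearMap.mulRight R f ∘ₗ LinearMap.mulLeft R f)
  have hN : ∀ b, b ∈ N ↔ ∃ c ∈ B, f * b * f = c * f := fun b => by
    simp only [N, Submodule.mem_comap, LinearMap.mem_range, LinearMap.comp_apply,
      LinearMap.mulLeft_apply, LinearMap.mulRight_apply, Subtype.exists, Submodule.subtype_apply,
      Subalgebra.mem_toSubmodule, exists_prop, eq_comm]
  have key : window B x (x * z * x) e S ≤ N := by
    refine h.window_induction ?_ ?_ ?_ ?_ S <;> intro b hb c hc <;> rw [hN]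
    · refine ⟨a • (b * c), B.smul_mem (mul_mem hb hc) _, ?_⟩
      rw [k.f_comm _ (mul_mem hb hc), mul_assoc _ f f, k.f_f, mul_smul_comm, smul_mul_assoc]
    · refine ⟨b * c, mul_mem hb hc, ?_⟩
      rw [mul_assoc b, ← mul_assoc f b, k.f_comm b hb, mul_assoc, mul_assoc, mul_assoc e,
        ← k.f_comm c hc, ← mul_assoc e, ← mul_assoc f, ← mul_assoc f, k.f_e_f,
        k.f_comm c hc, mul_assoc]
    · refine ⟨((l⁻¹ : Rˣ) : R) • (b * c), B.smul_mem (mul_mem hb hc) _, ?_⟩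
      rw [mul_assoc b, ← mul_assoc f b, k.f_comm b hb, mul_assoc, mul_assoc, mul_assoc (x : A),
        ← k.f_comm c hc, ← mul_assoc (x : A), ← mul_assoc f, ← mul_assoc f, k.f_x_f,
        smul_mul_assoc, k.f_comm c hc, mul_smul_comm, smul_mul_assoc, mul_assoc]
    · obtain ⟨b', hb', he⟩ := h.ebe b hb
      refine ⟨b' * c, mul_mem (h.le hb') hc, ?_⟩
      have h1 : f * x = f * e * ((y⁻¹ : Aˣ) : A) := by
        rw [Units.eq_mul_inv_iff_mul_eq, k.f_x_y]
      have h2 : ((y⁻¹ : Aˣ) : A) * b = b * ((y⁻¹ : Aˣ) : A) :=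
        (Commute.units_inv_left (k.y_comm b hb : Commute _ _)).eq
      calc f * (x * b * ((x⁻¹ : Aˣ) : A) * c) * f
          = (f * x) * b * (((x⁻¹ : Aˣ) : A) * (c * f)) := by simp only [mul_assoc]
        _ = f * e * (((y⁻¹ : Aˣ) : A) * b) * (((x⁻¹ : Aˣ) : A) * f) * c := by
          rw [h1, ← k.f_comm c hc]; simp only [mul_assoc]
        _ = f * (e * b * e) * f * c := by
          rw [h2, ← k.y_e_f]; simp only [mul_assoc, Units.inv_mul_cancel_left]
        _ = b' * c * f := by
          rw [he, ← mul_assoc, k.f_comm b' (h.le hb'), mul_assoc b', mul_assoc b', k.f_e_f,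
            mul_assoc, k.f_comm c hc, mul_assoc]
  exact fun b hb => (hN b).1 (key (hB₁ b hb))

theorem next_decomposes {l : R} (k : BMWLink B x y e f l a) {w : Aˣ}
    (hle : B ≤ B₁) (hx : (x : A) ∈ B₁) (hxi : ((x⁻¹ : Aˣ) : A) ∈ B₁) (he : e ∈ B₁)
    (hB₁ : ∀ b ∈ B₁, b ∈ window B x w e S) : Decomposes B B₁ y w f S := by
  intro b hb
  refine window_le ?_ ?_ ?_ (hB₁ b hb)
  · refine fun b hb c hc => Submodule.subset_span (Or.inl ⟨?_, ?_, ?_⟩)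
    · refine ⟨b * ((x⁻¹ : Aˣ) : A) * c, mul_mem (mul_mem (hle hb) hxi) (hle hc), ?_⟩
      calc y * (b * e * c) * f = (y * b) * e * (c * f) := by simp only [mul_assoc]
        _ = b * (y * e * f) * c := by
          rw [k.y_comm b hb, ← k.f_comm c hc]; simp only [mul_assoc]
        _ = _ := by rw [k.y_e_f]; simp only [mul_assoc]; rw [k.f_comm c hc]
    · refine ⟨b * ((x⁻¹ : Aˣ) : A) * c, mul_mem (mul_mem (hle hb) hxi) (hle hc), ?_⟩
      calc f * (b * e * c) * y = (f * b) * e * (c * y) := by simp only [mul_assoc]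
        _ = b * (f * e * y) * c := by
          rw [k.f_comm b hb, ← k.y_comm c hc]; simp only [mul_assoc]
        _ = (f * b) * (((x⁻¹ : Aˣ) : A) * c) := by
          rw [k.f_e_y, k.f_comm b hb]; simp only [mul_assoc]
        _ = _ := by simp only [mul_assoc]
    · have h1 : y * (b * e * c) * y
          = (b * ((x⁻¹ : Aˣ) : A)) * f * (((x⁻¹ : Aˣ) : A) * c) := by
        calc y * (b * e * c) * y = (y * b) * e * (c * y) := by simp only [mul_assoc]
          _ = b * (y * e * y) * c := by
            rw [k.y_comm b hb, ← k.y_comm c hc]; simp only [mul_assoc]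
          _ = _ := by rw [k.y_e_y]; simp only [mul_assoc]
      rw [h1]
      exact mul_e_mul_mem_filt (mul_mem (hle hb) hxi) (mul_mem hxi (hle hc))
  · refine fun b hb c hc => Submodule.subset_span (Or.inl ⟨?_, ?_, ?_⟩)
    · refine ⟨b * e * c, mul_mem (mul_mem (hle hb) he) (hle hc), ?_⟩
      calc y * (b * x * c) * f = (y * b) * x * (c * f) := by simp only [mul_assoc]
        _ = b * (y * x * f) * c := by
          rw [k.y_comm b hb, ← k.f_comm c hc]; simp only [mul_assoc]
        _ = _ := by rw [k.y_x_f]; simp only [mul_assoc]; rw [k.f_comm c hc]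
    · refine ⟨b * e * c, mul_mem (mul_mem (hle hb) he) (hle hc), ?_⟩
      calc f * (b * x * c) * y = (f * b) * x * (c * y) := by simp only [mul_assoc]
        _ = b * (f * x * y) * c := by
          rw [k.f_comm b hb, ← k.y_comm c hc]; simp only [mul_assoc]
        _ = (f * b) * (e * c) := by
          rw [k.f_x_y, k.f_comm b hb]; simp only [mul_assoc]
        _ = _ := by simp only [mul_assoc]
    · have h1 : y * (b * x * c) * y = (b * x) * y * (x * c) := by
        calc y * (b * x * c) * y = (y * b) * x * (c * y) := by simp only [mul_assoc]
          _ = b * (y * x * y) * c := by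
            rw [k.y_comm b hb, ← k.y_comm c hc]; simp only [mul_assoc]
          _ = _ := by rw [k.braid]; simp only [mul_assoc]
      rw [h1]
      exact mul_x_mul_mem_filt (mul_mem (hle hb) hx) (mul_mem hx (hle hc))
  · exact fun t ht c hc => Submodule.subset_span (Or.inr ⟨t, ht, c, hc, rfl⟩)

end BMWLink

end BMWLevel

end Level

namespace CBMW

section Relations

variable {R : Type} [CommRing R] (P : Params R)

theorem pr_eq {a b : F R} (h : Rel P a b) : pr P a = pr P b := RingQuot.mkAlgHom_rel R h

/-- `Xᵢ` as a unit. -/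
def uX (i : ℕ) : (Alg P)ˣ where
  val := Xg P i
  inv := Xgi P i
  val_inv := by
    by_cases h : i = 0 ∨ P.n - 1 < i
    · rw [Xg, Xgi, pr_eq P (Rel.X_invalid h), pr_eq P (Rel.Xi_invalid h), map_one, mul_one]
    · have := pr_eq P (Rel.X_inv_right (P := P) (i := i) (by omega) (by omega))
      rwa [map_mul, map_one] at this
  inv_val := by
    by_cases h : i = 0 ∨ P.n - 1 < i
    · rw [Xg, Xgi, pr_eq P (Rel.X_invalid h), pr_eq P (Rel.Xi_invalid h), map_one, mul_one]
    · have := pr_eq P (Rel.X_inv_left (P := P) (i := i) (by omega) (by omega))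
      rwa [map_mul, map_one] at this

/-- `Y` as a unit. -/
def uY : (Alg P)ˣ where
  val := Yg P
  inv := Ygi P
  val_inv := by
    have := pr_eq P (Rel.Y_inv_right (P := P))
    rwa [map_mul, map_one] at this
  inv_val := by
    have := pr_eq P (Rel.Y_inv_left (P := P))
    rwa [map_mul, map_one] at this

/-- `Y'_{m+1}` as a unit. -/
def uJM : ℕ → (Alg P)ˣ
  | 0 => uY P
  | m + 1 => uX P (m + 1) * uJM m * uX P (m + 1)

theorem coe_uX (i : ℕ) : (uX P i : Alg P) = Xg P i := rfl

theorem coe_uX_inv (i : ℕ) : (((uX P i)⁻¹ : (Alg P)ˣ) : Alg P) = Xgi P i := rfl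

theorem coe_uY : (uY P : Alg P) = Yg P := rfl

theorem coe_uY_inv : (((uY P)⁻¹ : (Alg P)ˣ) : Alg P) = Ygi P := rfl

theorem coe_uJM (m : ℕ) : (uJM P m : Alg P) = Yp P (m + 1) := by
  induction m with
  | zero => simp [uJM, Yp, downX, upX, coe_uY]
  | succ m ih =>
    rw [uJM, Units.val_mul, Units.val_mul, ih, coe_uX]
    simp only [Yp, Nat.add_sub_cancel, downX, upX, mul_assoc]

theorem coe_uJM_inv (m : ℕ) : (((uJM P m)⁻¹ : (Alg P)ˣ) : Alg P) = YpInv P (m + 1) := by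
  induction m with
  | zero => simp [uJM, YpInv, downXi, upXi, coe_uY_inv]
  | succ m ih =>
    rw [uJM, mul_inv_rev, mul_inv_rev, Units.val_mul, Units.val_mul, ih, coe_uX_inv]
    simp only [YpInv, Nat.add_sub_cancel, downXi, upXi, mul_assoc]

theorem Ypow_eq (m : ℕ) (s : ℤ) : Ypow P (m + 1) s = ((uJM P m ^ s : (Alg P)ˣ) : Alg P) := by
  rw [Ypow]
  split_ifs with h
  · lift s to ℕ using h
    simp [coe_uJM]
  · obtain ⟨n, rfl⟩ : ∃ n : ℕ, s = -n := ⟨(-s).toNat, by omega⟩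
    rw [← coe_uJM_inv, ← Units.val_pow_eq_pow_val]
    simp

variable {P}

theorem X_E {i : ℕ} (h1 : 1 ≤ i) (h2 : i ≤ P.n - 1) : Xg P i * Eg P i = (P.lam : R) • Eg P i := by
  have := pr_eq P (Rel.untwist_right h1 h2)
  rwa [map_mul, map_smul] at this

theorem E_X {i : ℕ} (h1 : 1 ≤ i) (h2 : i ≤ P.n - 1) : Eg P i * Xg P i = (P.lam : R) • Eg P i := by
  have := pr_eq P (Rel.untwist_left h1 h2)
  rwa [map_mul, map_smul] at this

theorem E_E {i : ℕ} (h1 : 1 ≤ i) (h2 : i ≤ P.n - 1) : Eg P i * Eg P i = P.A 0 • Eg P i := by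
  have := pr_eq P (Rel.E_sq h1 h2)
  rwa [map_mul, map_smul] at this

theorem X_sub_Xi {i : ℕ} (h1 : 1 ≤ i) (h2 : i ≤ P.n - 1) :
    Xg P i - Xgi P i = P.delta • (1 - Eg P i) := by
  have := pr_eq P (Rel.skein h1 h2)
  rwa [map_sub, map_smul, map_sub, map_one] at this

theorem X_X_E {i j : ℕ} (h1 : 1 ≤ i) (h2 : i ≤ P.n - 1) (h3 : 1 ≤ j) (h4 : j ≤ P.n - 1)
    (h : j = i + 1 ∨ i = j + 1) : Xg P i * Xg P j * Eg P i = Eg P j * Eg P i := by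
  have := pr_eq P (Rel.XXE h1 h2 h3 h4 h)
  rwa [map_mul, map_mul, map_mul] at this

theorem E_X_X {i j : ℕ} (h1 : 1 ≤ i) (h2 : i ≤ P.n - 1) (h3 : 1 ≤ j) (h4 : j ≤ P.n - 1)
    (h : j = i + 1 ∨ i = j + 1) : Eg P j * Xg P i * Xg P j = Eg P j * Eg P i := by
  have := pr_eq P (Rel.EXX h1 h2 h3 h4 h)
  rw [map_mul, map_mul, map_mul] at this
  exact this.symm

theorem X_comm_X {i j : ℕ} (h1 : 1 ≤ i) (h2 : i ≤ P.n - 1) (h3 : 1 ≤ j) (h4 : j ≤ P.n - 1)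
    (h : i + 2 ≤ j ∨ j + 2 ≤ i) : Commute (Xg P i) (Xg P j) := by
  have := pr_eq P (Rel.XX_far h1 h2 h3 h4 h)
  rwa [map_mul, map_mul] at this

theorem X_comm_E {i j : ℕ} (h1 : 1 ≤ i) (h2 : i ≤ P.n - 1) (h3 : 1 ≤ j) (h4 : j ≤ P.n - 1)
    (h : i + 2 ≤ j ∨ j + 2 ≤ i) : Commute (Xg P i) (Eg P j) := by
  have := pr_eq P (Rel.XE_far h1 h2 h3 h4 h)
  rwa [map_mul, map_mul] at this

theorem E_comm_E {i j : ℕ} (h1 : 1 ≤ i) (h2 : i ≤ P.n - 1) (h3 : 1 ≤ j) (h4 : j ≤ P.n - 1)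
    (h : i + 2 ≤ j ∨ j + 2 ≤ i) : Commute (Eg P i) (Eg P j) := by
  have := pr_eq P (Rel.EE_far h1 h2 h3 h4 h)
  rwa [map_mul, map_mul] at this

theorem Y_comm_X {i : ℕ} (h1 : 2 ≤ i) (h2 : i ≤ P.n - 1) : Commute (Yg P) (Xg P i) := by
  have := pr_eq P (Rel.YX_comm h1 h2)
  rwa [map_mul, map_mul] at this

theorem Y_comm_E {i : ℕ} (h1 : 2 ≤ i) (h2 : i ≤ P.n - 1) : Commute (Yg P) (Eg P i) := by
  have := pr_eq P (Rel.YE_comm h1 h2)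
  rwa [map_mul, map_mul] at this

theorem braid {i : ℕ} (h1 : 1 ≤ i) (h2 : i + 1 ≤ P.n - 1) :
    Xg P (i + 1) * Xg P i * Xg P (i + 1) = Xg P i * Xg P (i + 1) * Xg P i := by
  have := pr_eq P (Rel.braid h1 h2)
  rw [map_mul, map_mul, map_mul, map_mul] at this
  exact this.symm

theorem E_E_E_down {i : ℕ} (h1 : 1 ≤ i) (h2 : i + 1 ≤ P.n - 1) :
    Eg P (i + 1) * Eg P i * Eg P (i + 1) = Eg P (i + 1) := by
  have := pr_eq P (Rel.EEE_down h1 h2)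
  rwa [map_mul, map_mul] at this

theorem X_Y_X_comm_Y (h : 2 ≤ P.n) : Commute (Xg P 1 * Yg P * Xg P 1) (Yg P) := by
  have := pr_eq P (Rel.braidB h)
  simp only [map_mul] at this
  exact this.trans (by simp only [Yg, Xg, mul_assoc])

theorem Y_X_Y_E (h : 2 ≤ P.n) : Yg P * Xg P 1 * Yg P * Eg P 1 = P.laminv • Eg P 1 := by
  have := pr_eq P (Rel.YXYE h)
  rwa [map_mul, map_mul, map_mul, map_smul] at this

theorem E_Y_X_Y (h : 2 ≤ P.n) : Eg P 1 * (Yg P * Xg P 1 * Yg P) = P.laminv • Eg P 1 := by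
  have := pr_eq P (Rel.EYXY h)
  rwa [map_mul, map_mul, map_mul, map_smul] at this

theorem E_Y_pow_E (h : 2 ≤ P.n) {m : ℕ} (hm : m ≤ P.k - 1) :
    Eg P 1 * Yg P ^ m * Eg P 1 = P.A m • Eg P 1 := by
  have := pr_eq P (Rel.EYE h hm)
  rwa [map_mul, map_mul, map_pow, map_smul] at this

theorem Y_pow_k : Yg P ^ P.k = ∑ i ∈ Finset.range P.k, P.qc i • Yg P ^ i := by
  have := pr_eq P (Rel.cyclo (P := P))
  simp only [map_pow, map_sum, map_smul] at this
  exact this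

end Relations

section Tower

variable {R : Type} [CommRing R] (P : Params R)

/-- The tower `R ≤ B₁ ≤ B₂ ≤ ⋯`. -/
def tower : ℕ → Subalgebra R (Alg P)
  | 0 => ⊥
  | m + 1 => Bsub P (m + 1)

variable {P}

theorem Y_mem_Bsub (l : ℕ) : Yg P ∈ Bsub P l := Algebra.subset_adjoin (Or.inl (Or.inl rfl))

theorem Yi_mem_Bsub (l : ℕ) : Ygi P ∈ Bsub P l := Algebra.subset_adjoin (Or.inl (Or.inr rfl))

theorem X_mem_Bsub {i l : ℕ} (h1 : 1 ≤ i) (h2 : i + 1 ≤ l) : Xg P i ∈ Bsub P l :=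
  Algebra.subset_adjoin (Or.inr ⟨i, h1, h2, Or.inl rfl⟩)

theorem Xi_mem_Bsub {i l : ℕ} (h1 : 1 ≤ i) (h2 : i + 1 ≤ l) : Xgi P i ∈ Bsub P l :=
  Algebra.subset_adjoin (Or.inr ⟨i, h1, h2, Or.inr (Or.inl rfl)⟩)

theorem E_mem_Bsub {i l : ℕ} (h1 : 1 ≤ i) (h2 : i + 1 ≤ l) : Eg P i ∈ Bsub P l :=
  Algebra.subset_adjoin (Or.inr ⟨i, h1, h2, Or.inr (Or.inr rfl)⟩)

theorem Bsub_le {l : ℕ} {T : Subalgebra R (Alg P)} (hY : Yg P ∈ T) (hYi : Ygi P ∈ T)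
    (hX : ∀ i, 1 ≤ i → i + 1 ≤ l → Xg P i ∈ T) (hXi : ∀ i, 1 ≤ i → i + 1 ≤ l → Xgi P i ∈ T)
    (hE : ∀ i, 1 ≤ i → i + 1 ≤ l → Eg P i ∈ T) : Bsub P l ≤ T := by
  rw [Bsub, Algebra.adjoin_le_iff]
  rintro y ((rfl | rfl) | ⟨i, h1, h2, rfl | rfl | rfl⟩)
  exacts [hY, hYi, hX i h1 h2, hXi i h1 h2, hE i h1 h2]

theorem Bsub_mono {l l' : ℕ} (h : l ≤ l') : Bsub P l ≤ Bsub P l' :=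
  Bsub_le (Y_mem_Bsub _) (Yi_mem_Bsub _) (fun _ h1 h2 => X_mem_Bsub h1 (h2.trans h))
    (fun _ h1 h2 => Xi_mem_Bsub h1 (h2.trans h)) (fun _ h1 h2 => E_mem_Bsub h1 (h2.trans h))

theorem tower_le_Bsub (m : ℕ) : tower P m ≤ Bsub P m := by
  cases m with
  | zero => exact bot_le
  | succ m => exact le_rfl

theorem tower_le_succ (m : ℕ) : tower P m ≤ tower P (m + 1) :=
  (tower_le_Bsub m).trans (Bsub_mono (Nat.le_succ m))

theorem tower_succ_le {m : ℕ} {T : Subalgebra R (Alg P)} (h : tower P (m + 1) ≤ T)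
    (hX : Xg P (m + 1) ∈ T) (hXi : Xgi P (m + 1) ∈ T) (hE : Eg P (m + 1) ∈ T) :
    tower P (m + 2) ≤ T := by
  refine Bsub_le (h (Y_mem_Bsub _)) (h (Yi_mem_Bsub _)) (fun i h1 h2 => ?_) (fun i h1 h2 => ?_)
    (fun i h1 h2 => ?_) <;> obtain h3 | rfl : i + 1 ≤ m + 1 ∨ i = m + 1 := by omega
  exacts [h (X_mem_Bsub h1 h3), hX, h (Xi_mem_Bsub h1 h3), hXi, h (E_mem_Bsub h1 h3), hE]

theorem commute_Bsub {l : ℕ} {a : Alg P} (hY : Commute a (Yg P))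
    (hX : ∀ i, 1 ≤ i → i + 1 ≤ l → Commute a (Xg P i))
    (hE : ∀ i, 1 ≤ i → i + 1 ≤ l → Commute a (Eg P i)) : ∀ b ∈ Bsub P l, Commute a b := by
  have hle : Bsub P l ≤ Subalgebra.centralizer R {a} := by
    refine Bsub_le ?_ ?_ (fun i h1 h2 => ?_) (fun i h1 h2 => ?_) (fun i h1 h2 => ?_) <;>
    rw [Subalgebra.mem_centralizer_iff] <;> rintro _ rfl
    · exact hY
    · exact Commute.units_inv_right (u := uY P) hY
    · exact hX i h1 h2
    · exact Commute.units_inv_right (u := uX P i) (hX i h1 h2)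
    · exact hE i h1 h2
  exact fun b hb => (Subalgebra.mem_centralizer_iff R).1 (hle hb) a rfl

theorem X_commute_tower {m j : ℕ} (h1 : m + 1 ≤ j) (h2 : j ≤ P.n - 1) :
    ∀ b ∈ tower P m, Commute (Xg P j) b := by
  cases m with
  | zero =>
    intro b hb
    obtain ⟨r, rfl⟩ := Algebra.mem_bot.1 hb
    exact (Algebra.commutes r _).symm
  | succ m =>
    exact commute_Bsub (Y_comm_X (by omega) h2).symm
      (fun i hi hi' => X_comm_X (by omega) h2 hi (by omega) (by omega))
      (fun i hi hi' => X_comm_E (by omega) h2 hi (by omega) (by omega))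

theorem E_commute_tower {m j : ℕ} (h1 : m + 1 ≤ j) (h2 : j ≤ P.n - 1) :
    ∀ b ∈ tower P m, Commute (Eg P j) b := by
  cases m with
  | zero =>
    intro b hb
    obtain ⟨r, rfl⟩ := Algebra.mem_bot.1 hb
    exact (Algebra.commutes r _).symm
  | succ m =>
    exact commute_Bsub (Y_comm_E (by omega) h2).symm
      (fun i hi hi' => (X_comm_E hi (by omega) (by omega) h2 (by omega)).symm)
      (fun i hi hi' => E_comm_E (by omega) h2 hi (by omega) (by omega))

theorem uJM_mem (m : ℕ) : (uJM P m : Alg P) ∈ tower P (m + 1) := by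
  induction m with
  | zero => exact Y_mem_Bsub 1
  | succ m ih =>
    rw [uJM, Units.val_mul, Units.val_mul]
    exact mul_mem (mul_mem (X_mem_Bsub (by omega) le_rfl) (tower_le_succ _ ih))
      (X_mem_Bsub (by omega) le_rfl)

theorem uJM_inv_mem (m : ℕ) : (((uJM P m)⁻¹ : (Alg P)ˣ) : Alg P) ∈ tower P (m + 1) := by
  induction m with
  | zero => exact Yi_mem_Bsub 1
  | succ m ih =>
    rw [uJM, mul_inv_rev, mul_inv_rev, Units.val_mul, Units.val_mul]
    exact mul_mem (Xi_mem_Bsub (by omega) le_rfl) (mul_mem (tower_le_succ _ ih)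
      (Xi_mem_Bsub (by omega) le_rfl))

theorem uJM_zpow_mem (m : ℕ) (s : ℤ) : ((uJM P m ^ s : (Alg P)ˣ) : Alg P) ∈ tower P (m + 1) := by
  obtain ⟨n, rfl | rfl⟩ := s.eq_nat_or_neg
  · simpa using pow_mem (uJM_mem m) n
  · simpa [← inv_pow] using pow_mem (uJM_inv_mem m) n

theorem link {m : ℕ} (h : m + 2 ≤ P.n - 1) :
    BMWLink (tower P (m + 1)) (uX P (m + 1)) (uX P (m + 2)) (Eg P (m + 1)) (Eg P (m + 2))
      (P.lam : R) (P.A 0) where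
  y_comm b hb := X_commute_tower le_rfl h b hb
  f_comm b hb := E_commute_tower le_rfl h b hb
  f_x_y := E_X_X (by omega) (by omega) (by omega) h (by omega)
  y_x_f := X_X_E (by omega) (by omega) (by omega) (by omega) (by omega)
  e_y_x := E_X_X (by omega) (by omega) (by omega) (by omega) (by omega)
  x_y_e := X_X_E (by omega) (by omega) (by omega) (by omega) (by omega)
  f_e_f := E_E_E_down (by omega) h
  braid := braid (by omega) h
  y_f := X_E (by omega) h
  f_f := E_E (by omega) h

theorem uJM_commute {m : ℕ} (h : m ≤ P.n - 1) : ∀ b ∈ tower P m, Commute (uJM P m : Alg P) b := by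
  induction m with
  | zero =>
    intro b hb
    obtain ⟨r, rfl⟩ := Algebra.mem_bot.1 hb
    exact (Algebra.commutes r _).symm
  | succ m ih =>
    have hlow : ∀ b ∈ tower P m, Commute (uJM P (m + 1) : Alg P) b := fun b hb => by
      have hx : Commute (Xg P (m + 1)) b := X_commute_tower le_rfl h b hb
      exact (hx.mul_left (ih (by omega) b hb)).mul_left hx
    cases m with
    | zero =>
      exact commute_Bsub (l := 1) (X_Y_X_comm_Y (by omega))
        (fun i _ _ => absurd ‹i + 1 ≤ 1› (by omega))
        (fun i _ _ => absurd ‹i + 1 ≤ 1› (by omega))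
    | succ m =>
      have k := link (P := P) (m := m) h
      set x := uX P (m + 1) with hx
      set y := uX P (m + 2) with hy
      set z := uJM P m
      have hJ : (uJM P (m + 1 + 1) : Alg P) = y * (x * z * x) * y := rfl
      have hyz : (y : Alg P) * z = z * y := k.y_comm _ (uJM_mem m)
      have hfz : Eg P (m + 2) * z = z * Eg P (m + 2) := k.f_comm _ (uJM_mem m)
      refine commute_Bsub (hlow _ (Y_mem_Bsub _)) (fun i h1 h2 => ?_) (fun i h1 h2 => ?_) <;>
      obtain h3 | rfl : i + 1 ≤ m + 1 ∨ i = m + 1 := by omega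
      · exact hlow _ (X_mem_Bsub h1 h3)
      · rw [hJ]
        change _ * (x : Alg P) = x * _
        calc (y : Alg P) * (x * z * x) * y * x = y * x * z * (x * y * x) := by
              simp only [mul_assoc]
          _ = y * x * (z * y) * x * y := by rw [← k.braid]; simp only [mul_assoc]
          _ = (y * x * y) * z * x * y := by rw [← hyz]; simp only [mul_assoc]
          _ = _ := by rw [k.braid]; simp only [mul_assoc]
      · exact hlow _ (E_mem_Bsub h1 h3)
      · rw [hJ]
        change _ * Eg P (m + 1) = Eg P (m + 1) * _
        calc (y : Alg P) * (x * z * x) * y * Eg P (m + 1)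
            = y * x * z * (x * y * Eg P (m + 1)) := by simp only [mul_assoc]
          _ = y * x * (z * Eg P (m + 2)) * Eg P (m + 1) := by
            rw [k.x_y_e]; simp only [mul_assoc]
          _ = (y * x * Eg P (m + 2)) * z * Eg P (m + 1) := by
            rw [← hfz]; simp only [mul_assoc]
          _ = Eg P (m + 1) * (Eg P (m + 2) * z) * Eg P (m + 1) := by
            rw [k.y_x_f]; simp only [mul_assoc]
          _ = Eg P (m + 1) * z * (Eg P (m + 2) * x * y) := by
            rw [k.f_x_y, hfz]; simp only [mul_assoc]
          _ = Eg P (m + 1) * (z * Eg P (m + 2)) * x * y := by simp only [mul_assoc]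
          _ = (Eg P (m + 1) * y * x) * z * x * y := by
            rw [← hfz, k.e_y_x]; simp only [mul_assoc]
          _ = _ := by simp only [mul_assoc]

theorem uJM_X_uJM_E {m : ℕ} (h : m + 1 ≤ P.n - 1) :
    (uJM P m : Alg P) * Xg P (m + 1) * uJM P m * Eg P (m + 1) = P.laminv • Eg P (m + 1) := by
  induction m with
  | zero => exact Y_X_Y_E (by omega)
  | succ m ih =>
    have k := link (P := P) (m := m) h
    have ih : (uJM P m : Alg P) * uX P (m + 1) * uJM P m * Eg P (m + 1)
      = P.laminv • Eg P (m + 1) := ih (by omega)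
    change ((uX P (m + 1) * uJM P m * uX P (m + 1) : (Alg P)ˣ) : Alg P) * uX P (m + 2) *
      ((uX P (m + 1) * uJM P m * uX P (m + 1) : (Alg P)ˣ) : Alg P) * Eg P (m + 2) = _
    have hyz := k.y_comm _ (uJM_mem m)
    generalize uX P (m + 1) = x at *
    generalize uX P (m + 2) = y at *
    generalize uJM P m = z at *
    simp only [Units.val_mul]
    calc (x : Alg P) * z * x * y * (x * z * x) * Eg P (m + 2)
        = x * z * (x * y * x) * z * x * Eg P (m + 2) := by simp only [mul_assoc]
      _ = x * (z * y) * x * (y * z) * x * Eg P (m + 2) := by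
        rw [← k.braid]; simp only [mul_assoc]
      _ = x * y * z * x * z * (y * x * Eg P (m + 2)) := by
        rw [← hyz, hyz]; nth_rw 1 [← hyz]; simp only [mul_assoc]
      _ = x * y * (z * x * z * Eg P (m + 1)) * Eg P (m + 2) := by
        rw [k.y_x_f]; simp only [mul_assoc]
      _ = P.laminv • ((x * y * Eg P (m + 1)) * Eg P (m + 2)) := by
        rw [ih, mul_smul_comm, smul_mul_assoc]
      _ = _ := by rw [k.x_y_e, k.f_e_f]

theorem E_uJM_X_uJM {m : ℕ} (h : m + 1 ≤ P.n - 1) :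
    Eg P (m + 1) * (uJM P m * Xg P (m + 1) * uJM P m) = P.laminv • Eg P (m + 1) := by
  induction m with
  | zero => exact E_Y_X_Y (by omega)
  | succ m ih =>
    have k := link (P := P) (m := m) h
    have ih : Eg P (m + 1) * (uJM P m * uX P (m + 1) * uJM P m)
      = P.laminv • Eg P (m + 1) := ih (by omega)
    change Eg P (m + 2) * (((uX P (m + 1) * uJM P m * uX P (m + 1) : (Alg P)ˣ) : Alg P)
      * uX P (m + 2) * ((uX P (m + 1) * uJM P m * uX P (m + 1) : (Alg P)ˣ) : Alg P)) = _
    have hyz := k.y_comm _ (uJM_mem m)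
    generalize uX P (m + 1) = x at *
    generalize uX P (m + 2) = y at *
    generalize uJM P m = z at *
    simp only [Units.val_mul]
    calc Eg P (m + 2) * ((x : Alg P) * z * x * y * (x * z * x))
        = Eg P (m + 2) * x * z * (x * y * x) * z * x := by simp only [mul_assoc]
      _ = Eg P (m + 2) * x * (z * y) * x * (y * z) * x := by
        rw [← k.braid]; simp only [mul_assoc]
      _ = (Eg P (m + 2) * x * y) * z * x * z * y * x := by
        rw [← hyz, hyz]; nth_rw 1 [← hyz]; simp only [mul_assoc]
      _ = Eg P (m + 2) * (Eg P (m + 1) * (z * x * z)) * y * x := by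
        rw [k.f_x_y]; simp only [mul_assoc]
      _ = P.laminv • (Eg P (m + 2) * (Eg P (m + 1) * y * x)) := by
        rw [ih, mul_smul_comm, smul_mul_assoc, smul_mul_assoc]; simp only [mul_assoc]
      _ = _ := by rw [k.e_y_x, ← mul_assoc, k.f_e_f]

theorem level {m : ℕ} (h : m + 1 ≤ P.n - 1)
    (hE : ∀ b ∈ tower P (m + 1), ∃ b' ∈ tower P m,
      Eg P (m + 1) * b * Eg P (m + 1) = b' * Eg P (m + 1)) :
    BMWLevel (tower P m) (tower P (m + 1)) (uX P (m + 1)) (uJM P m) (Eg P (m + 1)) P.delta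
      P.lam where
  le := tower_le_succ m
  z_mem := uJM_mem m
  zi_mem := uJM_inv_mem m
  skein := X_sub_Xi (by omega) h
  xe := X_E (by omega) h
  ex := E_X (by omega) h
  w_comm := uJM_commute h
  we := by
    rw [Units.eq_inv_mul_iff_mul_eq, Units.val_mul, Units.val_mul, mul_assoc _ _ (Eg P (m + 1)),
      coe_uX, X_E (by omega) h, mul_smul_comm, mul_smul_comm, ← mul_assoc, ← mul_assoc,
      uJM_X_uJM_E h, Params.laminv, smul_smul, Units.mul_inv, one_smul]
  ew := by
    rw [Units.eq_mul_inv_iff_mul_eq, Units.val_mul, Units.val_mul, ← mul_assoc, ← mul_assoc,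
      coe_uX, E_X (by omega) h, smul_mul_assoc, smul_mul_assoc, smul_mul_assoc,
      mul_assoc, mul_assoc, ← mul_assoc _ (Xg P (m + 1)), E_uJM_X_uJM h, Params.laminv,
      smul_smul, Units.mul_inv, one_smul]
  ebe := hE
  e_comm := E_commute_tower le_rfl h
  x_comm := X_commute_tower le_rfl h

end Tower

section Spanning

variable {R : Type} [CommRing R] {P : Params R}

/-- The subalgebra of elements whose left multiplication preserves `N`. -/
def leftStabilizer {A : Type*} [Ring A] [Algebra R A] (N : Submodule R A) : Subalgebra R A where
  carrier := {a | ∀ y ∈ N, a * y ∈ N}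
  mul_mem' {a b} ha hb y hy := by
    rw [mul_assoc]
    exact ha _ (hb _ hy)
  add_mem' {a b} ha hb y hy := by
    rw [add_mul]
    exact add_mem (ha _ hy) (hb _ hy)
  algebraMap_mem' r y hy := by
    rw [← Algebra.smul_def]
    exact N.smul_mem r hy

theorem uY_zpow_add (t : ℤ) : ((uY P ^ (t + P.k) : (Alg P)ˣ) : Alg P) =
    ∑ i ∈ Finset.range P.k, P.qc i • ((uY P ^ (t + i) : (Alg P)ˣ) : Alg P) := by
  have h : ∀ i : ℕ, ((uY P ^ (t + i) : (Alg P)ˣ) : Alg P) =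
      ((uY P ^ t : (Alg P)ˣ) : Alg P) * Yg P ^ i := fun i => by
    rw [zpow_add, Units.val_mul, zpow_natCast, Units.val_pow_eq_pow_val, coe_uY]
  rw [h, Y_pow_k, Finset.mul_sum]
  exact Finset.sum_congr rfl fun i _ => by rw [h, mul_smul_comm]

theorem tower_one_le_span (hq0 : P.qc 0 = (P.q0 : R)) {p q : ℤ} (hp : p ≤ 0) (hq : 0 ≤ q)
    (hpq : q = p + P.k - 1) : ∀ b ∈ tower P 1,
      b ∈ Submodule.span R {y | ∃ s ∈ Set.Icc p q, y = ((uY P ^ s : (Alg P)ˣ) : Alg P)} := by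
  obtain ⟨k, hk⟩ : ∃ k, P.k = k + 1 := ⟨P.k - 1, by omega⟩
  set N := Submodule.span R {y | ∃ s ∈ Set.Icc p q, y = ((uY P ^ s : (Alg P)ˣ) : Alg P)} with hN
  have hmem : ∀ s : ℤ, p ≤ s → s ≤ q → ((uY P ^ s : (Alg P)ˣ) : Alg P) ∈ N :=
    fun s h1 h2 => Submodule.subset_span ⟨s, ⟨h1, h2⟩, rfl⟩
  have hup : ((uY P ^ (q + 1) : (Alg P)ˣ) : Alg P) ∈ N := by
    rw [show q + 1 = p + P.k by omega, uY_zpow_add]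
    refine sum_mem fun i hi => N.smul_mem _ (hmem _ (by omega) ?_)
    have := Finset.mem_range.1 hi
    omega
  have hdown : ((uY P ^ (p - 1) : (Alg P)ˣ) : Alg P) ∈ N := by
    have h := uY_zpow_add (P := P) (p - 1)
    rw [hk, Finset.sum_range_succ', hq0, Nat.cast_zero, add_zero] at h
    have h' : ((uY P ^ (p - 1) : (Alg P)ˣ) : Alg P) = ((P.q0⁻¹ : Rˣ) : R) •
        ((P.q0 : R) • ((uY P ^ (p - 1) : (Alg P)ˣ) : Alg P)) := by
      rw [smul_smul, Units.inv_mul, one_smul]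
    rw [h', eq_sub_of_add_eq' h.symm]
    refine N.smul_mem _ (sub_mem (hmem _ (by omega) (by omega)) (sum_mem fun i hi =>
      N.smul_mem _ (hmem _ (by omega) ?_)))
    have := Finset.mem_range.1 hi
    omega
  have hle : tower P 1 ≤ leftStabilizer N := by
    refine Bsub_le (l := 1) (fun y hy => ?_) (fun y hy => ?_) (fun i _ _ => by omega)
      (fun i _ _ => by omega) (fun i _ _ => by omega)
    · suffices N ≤ N.comap (LinearMap.mulLeft R (Yg P)) from this hy
      rw [hN, Submodule.span_le]
      rintro _ ⟨s, ⟨h1, h2⟩, rfl⟩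
      rw [SetLike.mem_coe, Submodule.mem_comap, LinearMap.mulLeft_apply, ← coe_uY,
        ← Units.val_mul, ← zpow_one_add, add_comm]
      obtain h3 | rfl : s + 1 ≤ q ∨ s = q := by omega
      exacts [hmem _ (by omega) h3, hup]
    · suffices N ≤ N.comap (LinearMap.mulLeft R (Ygi P)) from this hy
      rw [hN, Submodule.span_le]
      rintro _ ⟨s, ⟨h1, h2⟩, rfl⟩
      rw [SetLike.mem_coe, Submodule.mem_comap, LinearMap.mulLeft_apply, ← coe_uY_inv,
        ← Units.val_mul, ← zpow_neg_one, ← zpow_add, add_comm, ← sub_eq_add_neg]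
      obtain h3 | rfl : p ≤ s - 1 ∨ s = p := by omega
      exacts [hmem _ h3 (by omega), hdown]
  intro b hb
  simpa using hle hb _ (hmem 0 hp hq)

theorem decomposes_zero (hq0 : P.qc 0 = (P.q0 : R)) {p q : ℤ} (hp : p ≤ 0) (hq : 0 ≤ q)
    (hpq : q = p + P.k - 1) : BMWLevel.Decomposes (tower P 0) (tower P 1) (uX P 1) (uJM P 0)
      (Eg P 1) (Set.Icc p q) := fun b hb => by
  refine Submodule.span_mono ?_ (tower_one_le_span hq0 hp hq hpq b hb)
  rintro _ ⟨s, hs, rfl⟩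
  exact Or.inr ⟨s, hs, 1, one_mem _, (mul_one _).symm⟩

theorem ebe_zero (hk : 1 ≤ P.k) (hq0 : P.qc 0 = (P.q0 : R)) (h : 2 ≤ P.n) :
    ∀ b ∈ tower P 1, ∃ b' ∈ tower P 0, Eg P 1 * b * Eg P 1 = b' * Eg P 1 := by
  intro b hb
  replace hb := tower_one_le_span hq0 (p := 0) (q := P.k - 1) le_rfl (by omega) (by ring) b hb
  induction hb using Submodule.span_induction with
  | mem y hy =>
    obtain ⟨s, ⟨h1, h2⟩, rfl⟩ := hy
    lift s to ℕ using h1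
    refine ⟨algebraMap R _ (P.A s), Subalgebra.algebraMap_mem _ _, ?_⟩
    rw [zpow_natCast, Units.val_pow_eq_pow_val, coe_uY, E_Y_pow_E h (by omega), Algebra.smul_def]
  | zero => exact ⟨0, zero_mem _, by simp⟩
  | add y z _ _ hy hz =>
    obtain ⟨c, hc, e1⟩ := hy
    obtain ⟨d, hd, e2⟩ := hz
    exact ⟨c + d, add_mem hc hd, by rw [mul_add, add_mul, e1, e2, add_mul]⟩
  | smul r y _ hy =>
    obtain ⟨c, hc, e1⟩ := hy
    exact ⟨r • c, Subalgebra.smul_mem _ hc r, by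
      rw [mul_smul_comm, smul_mul_assoc, e1, smul_mul_assoc]⟩

theorem tower_succ_le_leftStabilizer {m : ℕ} (h : m + 1 ≤ P.n - 1) {N : Submodule R (Alg P)}
    (hB : tower P (m + 1) ≤ leftStabilizer N) (hX : ∀ y ∈ N, Xg P (m + 1) * y ∈ N)
    (hE : ∀ y ∈ N, Eg P (m + 1) * y ∈ N) : tower P (m + 2) ≤ leftStabilizer N := by
  refine tower_succ_le hB hX ?_ hE
  have h1 : Xgi P (m + 1) = Xg P (m + 1) - P.delta • (1 - Eg P (m + 1)) := by
    rw [← X_sub_Xi (by omega) h, sub_sub_cancel]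
  have hX : Xg P (m + 1) ∈ leftStabilizer N := hX
  have hE : Eg P (m + 1) ∈ leftStabilizer N := hE
  rw [h1]
  exact sub_mem hX (Subalgebra.smul_mem _ (sub_mem (one_mem _) hE) _)

theorem tower_succ_le_window {m : ℕ} (h : m + 1 ≤ P.n - 1) {p q : ℤ} (hp : p ≤ 0) (hq : 0 ≤ q)
    (hL : BMWLevel (tower P m) (tower P (m + 1)) (uX P (m + 1)) (uJM P m) (Eg P (m + 1)) P.delta
      P.lam)
    (hD : BMWLevel.Decomposes (tower P m) (tower P (m + 1)) (uX P (m + 1)) (uJM P m)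
      (Eg P (m + 1)) (Set.Icc p q)) :
    ∀ b ∈ tower P (m + 2), b ∈ BMWLevel.window (tower P (m + 1)) (uX P (m + 1)) (uJM P (m + 1))
      (Eg P (m + 1)) (Set.Icc p q) := by
  intro b hb
  have h1 := tower_succ_le_leftStabilizer h
    (N := BMWLevel.window (tower P (m + 1)) (uX P (m + 1)) (uJM P (m + 1))
      (Eg P (m + 1)) (Set.Icc p q)) (fun b hb y hy => hL.mul_mem_window hb hy)
    (fun y hy => hL.x_mul_mem_window hp hq hD hy) (fun y hy => hL.e_mul_mem_window hD hy) hb 1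
    (BMWLevel.mem_window_of_mem (S := Set.Icc p q) ⟨hp, hq⟩ (one_mem _))
  rwa [mul_one] at h1

theorem level_and_decomposes (hk : 1 ≤ P.k) (hq0 : P.qc 0 = (P.q0 : R)) {p q : ℤ} (hp : p ≤ 0)
    (hq : 0 ≤ q) (hpq : q = p + P.k - 1) {m : ℕ} (h : m + 1 ≤ P.n - 1) :
    BMWLevel (tower P m) (tower P (m + 1)) (uX P (m + 1)) (uJM P m) (Eg P (m + 1)) P.delta P.lam ∧
    BMWLevel.Decomposes (tower P m) (tower P (m + 1)) (uX P (m + 1)) (uJM P m)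
      (Eg P (m + 1)) (Set.Icc p q) := by
  induction m with
  | zero =>
    exact ⟨level h (ebe_zero hk hq0 (by omega)), decomposes_zero hq0 hp hq hpq⟩
  | succ m ih =>
    obtain ⟨hL, hD⟩ := ih (by omega)
    have hB := tower_succ_le_window (by omega) hp hq hL hD
    exact ⟨level h (hL.next_ebe (link h) hB),
      BMWLevel.next_decomposes (link h) (tower_le_succ _) (X_mem_Bsub (by omega) le_rfl)
        (Xi_mem_Bsub (by omega) le_rfl) (E_mem_Bsub (by omega) le_rfl) hB⟩

end Spanning

section Alpha

variable {R : Type} [CommRing R] {P : Params R}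

theorem alpha_succ {a j m : ℕ} (s : ℤ) (hj : j ≤ m + 1) :
    alpha P a j (m + 1) s = alpha P a j m s * Eg P (m + 1) := by
  rw [alpha, alpha, show m + 1 + 1 - j = (m + 1 - j) + 1 by omega, List.range'_1_concat,
    List.map_append, List.prod_append, List.map_singleton, List.prod_singleton,
    show j + (m + 1 - j) = m + 1 by omega, ← mul_assoc]

theorem alpha_mul_X_last {a m : ℕ} (s : ℤ) (ha : a ≤ m + 1) :
    alpha P a (m + 1) m s * Xg P (m + 1) = alpha P a (m + 2) (m + 1) s := by
  rw [alpha, alpha, show m + 1 - (m + 1) = 0 by omega, show m + 1 + 1 - (m + 2) = 0 by omega,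
    show m + 2 - a = (m + 1 - a) + 1 by omega, List.range'_1_concat,
    List.map_append, List.prod_append, List.map_singleton, List.prod_singleton,
    show a + (m + 1 - a) = m + 1 by omega]
  simp [mul_assoc]

theorem alpha_mul_X {a j m : ℕ} (s : ℤ) (h1 : 1 ≤ j) (hj : j ≤ m) (hm : m + 1 ≤ P.n - 1) :
    alpha P a j m s * Xg P (m + 1) = alpha P a j (m + 1) s * Xgi P m := by
  obtain ⟨m, rfl⟩ : ∃ m', m = m' + 1 := ⟨m - 1, by omega⟩
  have h : Eg P (m + 1) * Xg P (m + 2) = Eg P (m + 1) * Eg P (m + 2) * Xgi P (m + 1) :=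
    (Units.eq_mul_inv_iff_mul_eq (c := uX P (m + 1))).2
      (E_X_X (by omega) hm (by omega) (by omega) (by omega))
  rw [alpha_succ (m := m + 1) s (by omega), alpha_succ (m := m) s hj, mul_assoc, h]
  simp only [mul_assoc]

theorem alpha_self {m : ℕ} (s : ℤ) :
    alpha P (m + 1) (m + 1) m s = ((uJM P m ^ s : (Alg P)ˣ) : Alg P) := by
  simp [alpha, Ypow_eq]

theorem alpha_mem {a j m : ℕ} (s : ℤ) (ha : 1 ≤ a) (haj : a ≤ j) (hj : j ≤ m + 1) :
    alpha P a j m s ∈ tower P (m + 1) := by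
  refine mul_mem (mul_mem ?_ (list_prod_mem fun y hy => ?_)) (list_prod_mem fun y hy => ?_)
  · obtain ⟨a, rfl⟩ : ∃ a', a = a' + 1 := ⟨a - 1, by omega⟩
    rw [Ypow_eq]
    exact Bsub_mono (by omega) (uJM_zpow_mem a s)
  · obtain ⟨t, ht, rfl⟩ := List.mem_map.1 hy
    rw [List.mem_range'_1] at ht
    exact X_mem_Bsub (by omega) (by omega)
  · obtain ⟨t, ht, rfl⟩ := List.mem_map.1 hy
    rw [List.mem_range'_1] at ht
    exact E_mem_Bsub (by omega) (by omega)

variable (P) in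
/-- The span of `α_{ajm}^s B` over `1 ≤ a ≤ j ≤ r` and `s ∈ P`. -/
def alphaSpan (r m : ℕ) (B : Subalgebra R (Alg P)) : Submodule R (Alg P) :=
  Submodule.span R {y | ∃ a j s, 1 ≤ a ∧ a ≤ j ∧ j ≤ r ∧ s ∈ Pset P.k ∧
    ∃ c ∈ B, y = alpha P a j m s * c}

theorem alpha_mul_mem_alphaSpan {a j r m : ℕ} {s : ℤ} {B : Subalgebra R (Alg P)} {c : Alg P}
    (ha : 1 ≤ a) (haj : a ≤ j) (hj : j ≤ r) (hs : s ∈ Pset P.k) (hc : c ∈ B) :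
    alpha P a j m s * c ∈ alphaSpan P r m B :=
  Submodule.subset_span ⟨a, j, s, ha, haj, hj, hs, c, hc, rfl⟩

theorem mem_alphaSpan (hk : 1 ≤ P.k) (hq0 : P.qc 0 = (P.q0 : R)) {m : ℕ} (h : m + 1 ≤ P.n) :
    ∀ b ∈ tower P (m + 1), b ∈ alphaSpan P (m + 1) m (tower P m) := by
  have hp : ((P.k / 2 : ℕ) : ℤ) - ((P.k : ℤ) - 1) ≤ 0 := by omega
  have hq : (0 : ℤ) ≤ ((P.k / 2 : ℕ) : ℤ) := by omega
  induction m with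
  | zero =>
    intro b hb
    refine Submodule.span_mono ?_ (tower_one_le_span hq0 hp hq (by ring) b hb)
    rintro _ ⟨s, hs, rfl⟩
    refine ⟨1, 1, s, le_rfl, le_rfl, le_rfl, hs, 1, one_mem _, ?_⟩
    rw [alpha_self, mul_one, uJM]
  | succ m ih =>
    have hm : m + 1 ≤ P.n - 1 := by omega
    obtain ⟨hL, hD⟩ := level_and_decomposes hk hq0 hp hq (by ring) hm
    intro b hb
    have key : ∀ g : Alg P, (∀ c ∈ tower P m, Commute g c) →
        (∀ a j s, 1 ≤ a → a ≤ j → j ≤ m + 1 → s ∈ Pset P.k → ∀ c ∈ tower P (m + 1),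
          alpha P a j m s * g * c ∈ alphaSpan P (m + 2) (m + 1) (tower P (m + 1))) →
        ∀ b ∈ tower P (m + 1), ∀ c ∈ tower P (m + 1),
          b * g * c ∈ alphaSpan P (m + 2) (m + 1) (tower P (m + 1)) := by
      intro g hg hα b hb c hc
      suffices alphaSpan P (m + 1) m (tower P m) ≤
          (alphaSpan P (m + 2) (m + 1) (tower P (m + 1))).comap
            (LinearMap.mulRight R c ∘ₗ LinearMap.mulRight R g) from this (ih (by omega) b hb)
      rw [alphaSpan, Submodule.span_le]
      rintro _ ⟨a, j, s, h1, h2, h3, h4, c', hc', rfl⟩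
      simp only [SetLike.mem_coe, Submodule.mem_comap, LinearMap.comp_apply,
        LinearMap.mulRight_apply]
      rw [mul_assoc _ c', ← (hg c' hc').eq, ← mul_assoc, mul_assoc _ c']
      exact hα a j s h1 h2 h3 h4 _ (mul_mem (tower_le_succ m hc') hc)
    refine BMWLevel.window_le (key _ (E_commute_tower le_rfl hm) ?_)
      (key _ (X_commute_tower le_rfl hm) ?_) ?_ (tower_succ_le_window hm hp hq hL hD b hb)
    · intro a j s h1 h2 h3 h4 c hc
      rw [← alpha_succ s h3]
      exact alpha_mul_mem_alphaSpan h1 h2 (by omega) h4 hc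
    · intro a j s h1 h2 h3 h4 c hc
      obtain h5 | rfl : j ≤ m ∨ j = m + 1 := by omega
      · rw [coe_uX, alpha_mul_X s (by omega) h5 hm, mul_assoc]
        exact alpha_mul_mem_alphaSpan h1 h2 (by omega) h4
          (mul_mem (Xi_mem_Bsub (by omega) (by omega)) hc)
      · rw [coe_uX, alpha_mul_X_last s h2]
        exact alpha_mul_mem_alphaSpan h1 (by omega) le_rfl h4 hc
    · intro t ht c hc
      rw [← alpha_self]
      exact alpha_mul_mem_alphaSpan (by omega) le_rfl le_rfl ht hc

theorem mul_mul_E (hk : 1 ≤ P.k) (hq0 : P.qc 0 = (P.q0 : R)) {m : ℕ} (h : m + 2 ≤ P.n)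
    {x b : Alg P} (hx : x ∈ tower P (m + 2)) (hb : b ∈ tower P (m + 1)) :
    ∃ c ∈ tower P (m + 1), x * (b * Eg P (m + 1)) = c * Eg P (m + 1) := by
  have hp : ((P.k / 2 : ℕ) : ℤ) - ((P.k : ℤ) - 1) ≤ 0 := by omega
  have hq : (0 : ℤ) ≤ ((P.k / 2 : ℕ) : ℤ) := by omega
  have hm : m + 1 ≤ P.n - 1 := by omega
  obtain ⟨hL, hD⟩ := level_and_decomposes hk hq0 hp hq (by ring) hm
  have key := tower_succ_le_leftStabilizer hm
    (N := (tower P (m + 1)).toSubmodule.map (LinearMap.mulRight R (Eg P (m + 1)))) ?_ ?_ ?_ hx _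
    ⟨b, hb, rfl⟩
  · obtain ⟨c, hc, e⟩ := key
    exact ⟨c, hc, e.symm⟩
  · rintro y hy _ ⟨c, hc, rfl⟩
    exact ⟨y * c, (tower P (m + 1)).mul_mem hy hc, mul_assoc _ _ _⟩
  · rintro _ ⟨c, hc, rfl⟩
    obtain ⟨c', hc', e⟩ := hL.x_mul_mul_e hD c hc
    exact ⟨c', hc', e.symm.trans (mul_assoc _ _ _)⟩
  · rintro _ ⟨c, hc, rfl⟩
    obtain ⟨c', hc', e⟩ := hL.ebe c hc
    exact ⟨c', tower_le_succ m hc', e.symm.trans (mul_assoc _ _ _)⟩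

theorem mul_alpha_mem_alphaSpan (hk : 1 ≤ P.k) (hq0 : P.qc 0 = (P.q0 : R)) {m : ℕ}
    (h : m + 2 ≤ P.n) {x : Alg P} (hx : x ∈ tower P (m + 2)) {a j : ℕ} (s : ℤ) (ha : 1 ≤ a)
    (haj : a ≤ j) (hj : j ≤ m + 1) :
    x * alpha P a j (m + 1) s ∈ alphaSpan P (m + 1) (m + 1) (tower P m) := by
  obtain ⟨b, hb, e⟩ := mul_mul_E hk hq0 h hx (alpha_mem s ha haj hj)
  rw [alpha_succ s hj, e]
  suffices alphaSpan P (m + 1) m (tower P m) ≤ (alphaSpan P (m + 1) (m + 1) (tower P m)).comap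
      (LinearMap.mulRight R (Eg P (m + 1))) from
    this (mem_alphaSpan hk hq0 (by omega) b hb)
  rw [alphaSpan, Submodule.span_le]
  rintro _ ⟨a, j, s, h1, h2, h3, h4, c, hc, rfl⟩
  rw [SetLike.mem_coe, Submodule.mem_comap, LinearMap.mulRight_apply, mul_assoc,
    ← (E_commute_tower le_rfl (by omega) c hc).eq, ← mul_assoc, ← alpha_succ s h3]
  exact alpha_mul_mem_alphaSpan h1 h2 h3 h4 hc

theorem alphaChain_succ (l : ℕ) (ii jj : ℕ → ℕ) (ss : ℕ → ℤ) (m : ℕ) :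
    alphaChain P (l + 2) ii jj ss (m + 1) = alpha P (ii 1) (jj 1) (l + 1) (ss 1) *
      alphaChain P l (fun t => ii (t + 1)) (fun t => jj (t + 1)) (fun t => ss (t + 1)) m := by
  induction m with
  | zero => simp [alphaChain]
  | succ m ih =>
    rw [alphaChain, ih, alphaChain, mul_assoc,
      show l + 2 + 1 - 2 * (m + 1 + 1) = l + 1 - 2 * (m + 1) by omega]

theorem mem_Vg_succ {l m : ℕ} {x : Alg P} : x ∈ Vg P (l + 2) (m + 1) ↔
    ∃ a j s, 1 ≤ a ∧ a ≤ j ∧ j ≤ l + 1 ∧ s ∈ Pset P.k ∧ ∃ v ∈ Vg P l m,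
      x = alpha P a j (l + 1) s * v := by
  constructor
  · rintro ⟨ii, jj, ss, h, rfl⟩
    obtain ⟨h1, h2, h3, h4⟩ := h 1 le_rfl (by omega)
    refine ⟨ii 1, jj 1, ss 1, h1, h2, by omega, h4, _, ⟨_, _, _, fun t ht ht' => ?_, rfl⟩,
      alphaChain_succ l ii jj ss m⟩
    obtain ⟨h1, h2, h3, h4⟩ := h (t + 1) (by omega) (by omega)
    exact ⟨h1, h2, by omega, h4⟩
  · rintro ⟨a, j, s, h1, h2, h3, h4, _, ⟨ii, jj, ss, h, rfl⟩, rfl⟩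
    refine ⟨fun t => if t = 1 then a else ii (t - 1), fun t => if t = 1 then j else jj (t - 1),
      fun t => if t = 1 then s else ss (t - 1), fun t ht ht' => ?_, ?_⟩
    · obtain rfl | ⟨t, rfl⟩ : t = 1 ∨ ∃ t', t = t' + 2 := by
        obtain h | h : t = 1 ∨ 2 ≤ t := by omega
        exacts [Or.inl h, Or.inr ⟨t - 2, by omega⟩]
      · simp only [if_true]
        exact ⟨h1, h2, by omega, h4⟩
      · obtain ⟨h1, h2, h3, h4⟩ := h (t + 1) (by omega) (by omega)
        simp only [show t + 2 ≠ 1 by omega, if_false,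
          show t + 2 - 1 = t + 1 by omega]
        exact ⟨h1, h2, by omega, h4⟩
    · rw [alphaChain_succ]
      simp only [if_true, Nat.add_sub_cancel]
      congr 1
      clear h
      induction m with
      | zero => rfl
      | succ m ih => simp [alphaChain, ih]

end Alpha

end CBMW

/-- Lemma 10 of the paper. `V_{l,m}^g ⬝ B_{l-2m}` is a left ideal of `B_l`. -/
theorem statement9 {R : Type} [CommRing R] (P : Params R)
    (hn : 1 ≤ P.n) (hk : 1 ≤ P.k) (hq0 : P.qc 0 = (P.q0 : R))
    (hcomp : (P.lam : R) - P.laminv = P.delta * (1 - P.A 0))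
    (m l : ℕ) (hml : 2 * m ≤ l) (hln : l ≤ P.n) :
    ∀ x ∈ Bsub P l,
      ∀ y ∈ Submodule.span R
          {z : Alg P | ∃ v b, v ∈ Vg P l m ∧ b ∈ Bsub P (l - 2 * m) ∧ z = v * b},
        x * y ∈ Submodule.span R
          {z : Alg P | ∃ v b, v ∈ Vg P l m ∧ b ∈ Bsub P (l - 2 * m) ∧ z = v * b} := by
  induction m generalizing l with
  | zero =>
    intro x hx y hy
    induction hy using Submodule.span_induction with
    | mem y hy =>
      obtain ⟨v, b, ⟨ii, jj, ss, -, rfl⟩, hb, rfl⟩ := hy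
      refine Submodule.subset_span ⟨1, x * b, ⟨ii, jj, ss, fun t _ _ => by omega, rfl⟩,
        mul_mem hx hb, ?_⟩
      rw [alphaChain, one_mul, one_mul]
    | zero => simp
    | add y z _ _ hy hz => rw [mul_add]; exact add_mem hy hz
    | smul r y _ hy => rw [mul_smul_comm]; exact Submodule.smul_mem _ r hy
  | succ m ih =>
    obtain ⟨l, rfl⟩ : ∃ l', l = l' + 2 := ⟨l - 2, by omega⟩
    have hsub : l + 2 - 2 * (m + 1) = l - 2 * m := by omega
    rw [hsub]
    intro x hx y hy
    induction hy using Submodule.span_induction with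
    | mem y hy =>
      obtain ⟨v, b, hv, hb, rfl⟩ := hy
      obtain ⟨a, j, s, h1, h2, h3, -, v, hv', rfl⟩ := mem_Vg_succ.1 hv
      rw [mul_assoc, ← mul_assoc x]
      set W := Submodule.span R {z : Alg P | ∃ v b, v ∈ Vg P (l + 2) (m + 1) ∧
        b ∈ Bsub P (l - 2 * m) ∧ z = v * b}
      suffices alphaSpan P (l + 1) (l + 1) (tower P l) ≤
          W.comap (LinearMap.mulRight R (v * b)) from
        this (mul_alpha_mem_alphaSpan hk hq0 hln hx s h1 h2 h3)
      rw [alphaSpan, Submodule.span_le]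
      rintro _ ⟨a, j, s, h1, h2, h3, h4, c, hc, rfl⟩
      rw [SetLike.mem_coe, Submodule.mem_comap, LinearMap.mulRight_apply, mul_assoc]
      suffices Submodule.span R {z : Alg P | ∃ v b, v ∈ Vg P l m ∧ b ∈ Bsub P (l - 2 * m) ∧
          z = v * b} ≤ W.comap (LinearMap.mulLeft R (alpha P a j (l + 1) s)) from
        this (ih l (by omega) (by omega) c (tower_le_Bsub l hc) _
          (Submodule.subset_span ⟨v, b, hv', hb, rfl⟩))
      rw [Submodule.span_le]
      rintro _ ⟨v', b', hv', hb', rfl⟩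
      rw [SetLike.mem_coe, Submodule.mem_comap, LinearMap.mulLeft_apply, ← mul_assoc]
      exact Submodule.subset_span ⟨_, b', mem_Vg_succ.2 ⟨a, j, s, h1, h2, h3, h4, v', hv', rfl⟩,
        hb', rfl⟩
    | zero => simp
    | add y z _ _ hy hz => rw [mul_add]; exact add_mem hy hz
    | smul r y _ hy => rw [mul_smul_comm]; exact Submodule.smul_mem _ r hy
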